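/- arXiv:1503.03394 — 4 statements merged into one kernel-verified Lean document; each statement's English description precedes it below -/
import Mathlib

section
/- There is no binary linear [1988, 12, 992] code. Equivalently: every F₂-linear subspace C of F₂^1988 of dimension 12 contains a nonzero codeword of Hamming weight at most 991. -/
open Finset

/-- The ambient group. -/
abbrev GG := Fin 12 → ZMod 2

/-- sign of a bit -/
def sg (z : ZMod 2) : ℤ := if z = 0 then 1 else -1

theorem sg_add (z w : ZMod 2) : sg (z + w) = sg z * sg w := by
  revert z w; decide

theorem sg_cases (z : ZMod 2) : sg z = 1 ∨ sg z = -1 := by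
  revert z; decide

/-- additive characters -/
def chi (h x : GG) : ℤ := sg (h ⬝ᵥ x)

theorem chi_comm (h x : GG) : chi h x = chi x h := by
  unfold chi; rw [dotProduct_comm]

theorem chi_add_left (a b x : GG) : chi (a + b) x = chi a x * chi b x := by
  unfold chi; rw [add_dotProduct, sg_add]

theorem chi_add_right (x a b : GG) : chi x (a + b) = chi x a * chi x b := by
  unfold chi; rw [dotProduct_add, sg_add]

theorem chi_cases (a x : GG) : chi a x = 1 ∨ chi a x = -1 := sg_cases _

theorem chi_sq (a x : GG) : chi a x * chi a x = 1 := by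
  rcases chi_cases a x with h | h <;> rw [h] <;> norm_num

theorem chi_zero_left (x : GG) : chi 0 x = 1 := by simp [chi, sg]

theorem chi_zero_right (x : GG) : chi x 0 = 1 := by simp [chi, sg]

theorem gg_add_self (a : GG) : a + a = 0 := by
  funext i; exact CharTwo.add_self_eq_zero _

theorem gg_add_add (a s : GG) : a + (a + s) = s := by
  rw [← add_assoc, gg_add_self, zero_add]

theorem gg_add_add_r (s a : GG) : s + a + a = s := by
  rw [add_assoc, gg_add_self, add_zero]

theorem gg_add_eq_zero {a b : GG} (h : a + b = 0) : a = b := by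
  have := gg_add_add a b
  rw [h, add_zero] at this; exact this

theorem chi_nondeg (h : GG) (hh : ∀ x, chi h x = 1) : h = 0 := by
  funext i
  have := hh (Pi.single i 1)
  unfold chi at this
  rw [dotProduct_single_one] at this
  unfold sg at this
  by_contra hne
  simp only [Pi.zero_apply] at hne
  rw [if_neg hne] at this
  norm_num at this

open Classical in
theorem sub_sum (Y : Submodule (ZMod 2) GG) (h : GG) :
    ∑ y ∈ univ.filter (· ∈ Y), chi h y
      = if (∀ y ∈ Y, chi h y = 1) then ((univ.filter (· ∈ Y)).card : ℤ) else 0 := by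
  split_ifs with H
  · rw [Finset.sum_congr rfl (fun y hy => H y (by simpa using hy))]
    simp
  · push Not at H
    obtain ⟨y0, hy0, hne⟩ := H
    have hm : chi h y0 = -1 := (chi_cases h y0).resolve_left hne
    have : ∑ y ∈ univ.filter (· ∈ Y), chi h y = ∑ y ∈ univ.filter (· ∈ Y), chi h (y + y0) := by
      refine Finset.sum_bij' (fun y _ => y + y0) (fun y _ => y + y0) ?_ ?_ ?_ ?_ ?_
      · intro y hy; simp only [mem_filter, mem_univ, true_and] at hy ⊢; exact Y.add_mem hy hy0
      · intro y hy; simp only [mem_filter, mem_univ, true_and] at hy ⊢; exact Y.add_mem hy hy0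
      · intro y _; exact gg_add_add_r _ _
      · intro y _; exact gg_add_add_r _ _
      · intro y _; simp only [gg_add_add_r]
    simp only [chi_add_right, hm, mul_neg, mul_one, Finset.sum_neg_distrib] at this
    linarith

theorem card_GG : Fintype.card GG = 4096 := by simp

theorem sum_chi (h : GG) : ∑ y, chi h y = if h = 0 then 4096 else 0 := by
  classical
  have := sub_sum ⊤ h
  simp only [Submodule.mem_top, Finset.filter_true, true_implies] at this
  rw [this]
  by_cases hh : h = 0
  · subst hh
    rw [if_pos (fun y => chi_zero_left y), if_pos rfl, Finset.card_univ, card_GG]; norm_num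
  · rw [if_neg hh, if_neg (fun H => hh (chi_nondeg h H))]

/-- Fourier transform -/
def hat (v : GG → ℤ) (x : GG) : ℤ := ∑ h, v h * chi h x

theorem parseval (v w : GG → ℤ) : ∑ x, hat v x * hat w x = 4096 * ∑ h, v h * w h := by
  unfold hat
  simp_rw [Finset.sum_mul_sum]
  rw [Finset.sum_comm]
  rw [Finset.mul_sum]
  refine Finset.sum_congr rfl fun a _ => ?_
  rw [Finset.sum_comm]
  have : ∀ b, ∑ x, v a * chi a x * (w b * chi b x) = if b = a then 4096 * (v a * w b) else 0 := by
    intro b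
    have h1 : ∀ x, v a * chi a x * (w b * chi b x) = (v a * w b) * chi (a + b) x := by
      intro x; rw [chi_add_left]; ring
    simp_rw [h1]
    rw [← Finset.mul_sum, sum_chi]
    by_cases hab : b = a
    · subst hab; rw [if_pos (gg_add_self b), if_pos rfl]; ring
    · rw [if_neg hab, if_neg (fun h => hab (gg_add_eq_zero h).symm), mul_zero]
  simp_rw [this]
  simp

/-- autocorrelation -/
def conv (v : GG → ℤ) (s : GG) : ℤ := ∑ a, v a * v (a + s)

theorem hat_conv (v : GG → ℤ) (x : GG) : hat (conv v) x = hat v x * hat v x := by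
  unfold hat conv
  rw [Finset.sum_mul_sum]
  simp_rw [Finset.sum_mul]
  rw [Finset.sum_comm]
  refine Finset.sum_congr rfl fun a _ => ?_
  refine Fintype.sum_equiv (Equiv.addLeft a) _ _ ?_
  intro s
  simp only [Equiv.coe_addLeft]
  rw [chi_add_left]
  have := chi_sq a x
  linear_combination (- v a * v (a + s) * chi s x) * this

theorem conv_nonneg (v : GG → ℤ) (hv : ∀ h, 0 ≤ v h) (s : GG) : 0 ≤ conv v s :=
  Finset.sum_nonneg fun a _ => mul_nonneg (hv _) (hv _)

theorem third (v : GG → ℤ) (hv : ∀ h, 0 ≤ v h) : 0 ≤ ∑ x, hat v x ^ 3 := by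
  have := parseval v (conv v)
  simp_rw [hat_conv] at this
  have h1 : ∀ x, hat v x ^ 3 = hat v x * (hat v x * hat v x) := fun x => by ring
  simp_rw [h1]
  rw [this]
  exact mul_nonneg (by norm_num)
    (Finset.sum_nonneg fun h _ => mul_nonneg (hv h) (conv_nonneg v hv h))

theorem conv_sq_ge (v : GG → ℤ) (hv : ∀ h, 0 ≤ v h) (s : GG) (hs : s ≠ 0) :
    2 * ∑ a, v a ^ 2 * v (a + s) ^ 2 ≤ conv v s ^ 2 := by
  rw [sq (conv v s)]
  conv_rhs => unfold conv
  rw [Finset.sum_mul, Finset.mul_sum]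
  refine Finset.sum_le_sum fun a _ => ?_
  have hne : a ≠ a + s := fun h => hs (by simpa using h.symm)
  have : v a * v (a + s) + v (a + s) * v a ≤ ∑ b, v b * v (b + s) := by
    have h2 := Finset.sum_le_sum_of_subset_of_nonneg (Finset.subset_univ ({a, a + s} : Finset GG))
      (f := fun b => v b * v (b + s)) (fun b _ _ => mul_nonneg (hv _) (hv _))
    rw [Finset.sum_pair hne] at h2
    simp only [gg_add_add_r] at h2
    exact h2
  have h0 : 0 ≤ v a * v (a + s) := mul_nonneg (hv _) (hv _)
  nlinarith [mul_le_mul_of_nonneg_left this h0]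

theorem fourth (v : GG → ℤ) (hv : ∀ h, 0 ≤ v h) :
    4096 * (3 * (∑ h, v h ^ 2) ^ 2 - 2 * ∑ h, v h ^ 4) ≤ ∑ x, hat v x ^ 4 := by
  have := parseval (conv v) (conv v)
  simp_rw [hat_conv] at this
  have h1 : ∀ x, hat v x ^ 4 = hat v x * hat v x * (hat v x * hat v x) := fun x => by ring
  simp_rw [h1]
  rw [this]
  refine mul_le_mul_of_nonneg_left ?_ (by norm_num)
  have hc0 : conv v 0 = ∑ h, v h ^ 2 := by
    unfold conv; simp only [add_zero]; exact Finset.sum_congr rfl fun a _ => by ring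
  have hpt : ∀ s, 2 * ∑ a, v a ^ 2 * v (a + s) ^ 2
      + (if s = 0 then (∑ h, v h ^ 2) ^ 2 - 2 * ∑ h, v h ^ 4 else 0) ≤ conv v s * conv v s := by
    intro s
    split_ifs with hs
    · subst hs
      rw [hc0]
      simp only [add_zero]
      have : ∀ a, v a ^ 2 * v a ^ 2 = v a ^ 4 := fun a => by ring
      simp_rw [this]
      apply le_of_eq; ring
    · have := conv_sq_ge v hv s hs
      rw [add_zero]; linarith [sq (conv v s)]
  have hs := Finset.sum_le_sum (s := univ) fun s _ => hpt s
  rw [Finset.sum_add_distrib, Finset.sum_ite_eq' univ (0 : GG), if_pos (mem_univ _),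
    ← Finset.mul_sum, Finset.sum_comm] at hs
  have h3 : ∀ a, ∑ s, v a ^ 2 * v (a + s) ^ 2 = v a ^ 2 * ∑ h, v h ^ 2 := by
    intro a
    rw [← Finset.mul_sum]
    congr 1
    exact Fintype.sum_equiv (Equiv.addLeft a) _ _ fun s => rfl
  simp_rw [h3] at hs
  rw [← Finset.sum_mul] at hs
  nlinarith [hs]

theorem sum_hat (v : GG → ℤ) : ∑ x, hat v x = 4096 * v 0 := by
  unfold hat
  rw [Finset.sum_comm]
  simp_rw [← Finset.mul_sum, sum_chi]
  simp [mul_comm]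

theorem sum_hat_chi (v : GG → ℤ) (a : GG) : ∑ x, hat v x * chi a x = 4096 * v a := by
  have : ∀ x, hat v x * chi a x = hat (fun h => v (h + a)) x := by
    intro x
    unfold hat
    rw [Finset.sum_mul]
    refine Fintype.sum_equiv (Equiv.addRight a) _ _ ?_
    intro h
    simp only [Equiv.coe_addRight, gg_add_add_r]
    rw [chi_add_left]; ring
  simp_rw [this]
  rw [sum_hat]; simp

theorem hat_zero (v : GG → ℤ) : hat v 0 = ∑ h, v h := by
  unfold hat; simp [chi_zero_right]

theorem hat_ge (v : GG → ℤ) (hv : ∀ h, 0 ≤ v h) (x : GG) : - hat v 0 ≤ hat v x := by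
  rw [hat_zero]; unfold hat
  rw [← Finset.sum_neg_distrib]
  refine Finset.sum_le_sum fun h _ => ?_
  have := hv h
  rcases chi_cases h x with e | e <;> rw [e] <;> linarith

/-- The data obtained from an even code. -/
structure Dat (v f : GG → ℤ) : Prop where
  v_nonneg : ∀ h, 0 ≤ v h
  v_zero : v 0 = 0
  f_nonneg : ∀ x, 0 ≤ f x
  hat_eq : ∀ x, hat v x = 496 + (if x = 0 then 4096 else 0) - 1024 * f x

theorem Dat.sum_f {v f : GG → ℤ} (D : Dat v f) : ∑ x, f x = 1988 := by
  have := sum_hat v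
  rw [D.v_zero] at this
  simp_rw [D.hat_eq] at this
  rw [Finset.sum_sub_distrib, Finset.sum_add_distrib, ← Finset.mul_sum] at this
  simp at this
  linarith

theorem Dat.hat0 {v f : GG → ℤ} (D : Dat v f) : hat v 0 = 4592 - 1024 * f 0 := by
  rw [D.hat_eq, if_pos rfl]; ring

theorem Dat.f_le {v f : GG → ℤ} (D : Dat v f) (x : GG) (hx : x ≠ 0) : f x + f 0 ≤ 4 := by
  have := hat_ge v D.v_nonneg x
  rw [D.hat0, D.hat_eq, if_neg hx] at this
  omega

theorem Dat.f0_le {v f : GG → ℤ} (D : Dat v f) : f 0 ≤ 4 := by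
  have : 0 ≤ hat v 0 := by
    rw [hat_zero]; exact Finset.sum_nonneg fun h _ => D.v_nonneg h
  rw [D.hat0] at this
  omega

/-- Sum of a function of `f`, with a correction at zero. -/
theorem sum_corr (F : GG → ℤ) (P : GG → ℤ) (c : ℤ) (h : ∀ x, x ≠ 0 → F x = P x)
    (h0 : F 0 = P 0 + c) : ∑ x, F x = ∑ x, P x + c := by
  have : ∀ x, F x = P x + if x = 0 then c else 0 := by
    intro x
    split_ifs with hx
    · subst hx; exact h0
    · rw [h x hx, add_zero]
  simp_rw [this]
  rw [Finset.sum_add_distrib]; simp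

theorem sum_corr_le (F : GG → ℤ) (P : GG → ℤ) (c : ℤ) (h : ∀ x, x ≠ 0 → F x ≤ P x)
    (h0 : F 0 ≤ P 0 + c) : ∑ x, F x ≤ ∑ x, P x + c := by
  have : ∀ x, F x ≤ P x + if x = 0 then c else 0 := by
    intro x
    split_ifs with hx
    · subst hx; exact h0
    · have := h x hx; linarith
  refine (Finset.sum_le_sum fun x _ => this x).trans ?_
  rw [Finset.sum_add_distrib]; simp

theorem sum_affine {f : GG → ℤ} (hf : ∑ x, f x = 1988) (p q : ℤ) :
    ∑ x, (p + q * f x) = 4096 * p + 1988 * q := by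
  rw [Finset.sum_add_distrib, ← Finset.mul_sum, hf, Finset.sum_const, Finset.card_univ, card_GG]
  simp; ring

theorem Dat.f0_le_one {v f : GG → ℤ} (D : Dat v f) : f 0 ≤ 1 := by
  by_contra hcon
  have h3 := third v D.v_nonneg
  have hle := sum_corr_le (fun x => hat v x ^ 3)
    (fun x => 496 ^ 3 + (-(528) ^ 3 - 496 ^ 3) * f x)
    ((4592 - 1024 * f 0) ^ 3 - (496 ^ 3 + (-(528) ^ 3 - 496 ^ 3) * f 0)) (by
      intro x hx
      have h1 := D.f_le x hx
      have h2 := D.f_nonneg x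
      have h4 := D.f_nonneg 0
      simp only [D.hat_eq, if_neg hx]
      generalize f x = k at *
      have : k ≤ 4 := by omega
      interval_cases k <;> norm_num) (by simp only [D.hat0]; linarith)
  rw [sum_affine D.sum_f] at hle
  have h1 := D.f0_le
  generalize f 0 = k at *
  interval_cases k <;> first | omega | (norm_num at hle; linarith)

open Classical in
theorem Dat.no_four {v f : GG → ℤ} (D : Dat v f) (x : GG) (hx : x ≠ 0) : f x ≤ 3 := by
  by_contra hcon
  have hf0 : f 0 = 0 := by
    have := D.f_le x hx; have := D.f_nonneg 0; omega
  have hfx : f x = 4 := by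
    have := D.f_le x hx; have := D.f_nonneg 0; omega
  have hshift : ∀ y, hat v (y + x) = ∑ h, v h * chi h x * chi h y := by
    intro y; unfold hat
    exact Finset.sum_congr rfl fun h _ => by rw [chi_add_right]; ring
  set g : GG → ℤ := fun h => v h * (1 + chi h x) with hg
  set o : GG → ℤ := fun h => v h * (1 - chi h x) with ho
  have hatg : ∀ y, hat g y = hat v y + hat v (y + x) := by
    intro y; rw [hshift]; unfold hat; rw [← Finset.sum_add_distrib]
    exact Finset.sum_congr rfl fun h _ => by simp only [hg]; ring
  have hato : ∀ y, hat o y = hat v y - hat v (y + x) := by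
    intro y; rw [hshift]; unfold hat; rw [← Finset.sum_sub_distrib]
    exact Finset.sum_congr rfl fun h _ => by simp only [ho]; ring
  have gnn : ∀ h, 0 ≤ g h := by
    intro h; have := D.v_nonneg h
    simp only [hg]; rcases chi_cases h x with e | e <;> rw [e] <;> linarith
  have onn : ∀ h, 0 ≤ o h := by
    intro h; have := D.v_nonneg h
    simp only [ho]; rcases chi_cases h x with e | e <;> rw [e] <;> linarith
  have hv0 : hat v 0 = 4592 := by rw [D.hat0, hf0]; norm_num
  have hvx : hat v x = -3600 := by rw [D.hat_eq, if_neg hx, hfx]; norm_num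
  have hg0 : hat g 0 = 992 := by rw [hatg, zero_add, hv0, hvx]; norm_num
  have hgen : ∀ y, y ≠ 0 → y ≠ x → hat v y = 496 - 1024 * f y ∧
      hat v (y + x) = 496 - 1024 * f (y + x) := by
    intro y h1 h2
    refine ⟨by rw [D.hat_eq, if_neg h1]; ring, ?_⟩
    rw [D.hat_eq, if_neg (fun h => h2 (gg_add_eq_zero h))]; ring
  have hf1 : ∀ y, y ≠ 0 → y ≠ x → f y + f (y + x) ≤ 1 := by
    intro y h1 h2
    have h3 := hat_ge g gnn y
    rw [hg0, hatg, (hgen y h1 h2).1, (hgen y h1 h2).2] at h3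
    omega
  let W : Submodule (ZMod 2) GG :=
    { carrier := {y | ∀ h, g h ≠ 0 → chi h y = 1}
      add_mem' := by
        intro a b ha hb h hh
        rw [chi_add_right, ha h hh, hb h hh]; norm_num
      zero_mem' := fun h _ => chi_zero_right h
      smul_mem' := by
        intro c y hy h hh
        have hc : c = 0 ∨ c = 1 := by revert c; decide
        rcases hc with rfl | rfl
        · rw [zero_smul]; exact chi_zero_right h
        · rw [one_smul]; exact hy h hh }
  have memW : ∀ y, y ∈ W ↔ ∀ h, g h ≠ 0 → chi h y = 1 := fun y => Iff.rfl
  have xW : x ∈ W := by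
    rw [memW]; intro h hh
    rcases chi_cases h x with e | e
    · exact e
    · exfalso; apply hh; simp only [hg]; rw [e]; ring
  have zW : (0 : GG) ∈ W := W.zero_mem
  have W_iff : ∀ y, y ∈ W ↔ hat g y = 992 := by
    intro y
    rw [memW, ← hg0]
    have hd : hat g 0 - hat g y = ∑ h, g h * (1 - chi h y) := by
      rw [hat_zero]; unfold hat; rw [← Finset.sum_sub_distrib]
      exact Finset.sum_congr rfl fun h _ => by ring
    have hnn : ∀ h ∈ (univ : Finset GG), 0 ≤ g h * (1 - chi h y) := by
      intro h _; have := gnn h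
      rcases chi_cases h y with e | e <;> rw [e] <;> linarith
    constructor
    · intro H
      have : ∑ h, g h * (1 - chi h y) = 0 := by
        refine Finset.sum_eq_zero fun h _ => ?_
        by_cases hh : g h = 0
        · rw [hh, zero_mul]
        · rw [H h hh]; ring
      linarith
    · intro H h hh
      have hz : ∑ h, g h * (1 - chi h y) = 0 := by linarith
      rw [Finset.sum_eq_zero_iff_of_nonneg hnn] at hz
      have := hz h (mem_univ _)
      rcases mul_eq_zero.mp this with e | e
      · exact absurd e hh
      · linarith
  have W_gen : ∀ y, y ≠ 0 → y ≠ x → f y + f (y + x) = if y ∈ W then 0 else 1 := by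
    intro y h1 h2
    have h3 := hf1 y h1 h2
    have h4 := W_iff y
    rw [hatg, (hgen y h1 h2).1, (hgen y h1 h2).2] at h4
    have := D.f_nonneg y
    have := D.f_nonneg (y + x)
    split_ifs with hw
    · have := h4.mp hw; omega
    · have : ¬ (496 - 1024 * f y + (496 - 1024 * f (y + x)) = 992) := fun h => hw (h4.mpr h)
      omega
  have sumshift : ∑ y, f (y + x) = 1988 := by
    rw [← D.sum_f]
    exact Fintype.sum_equiv (Equiv.addRight x) _ _ fun s => rfl
  -- number of elements outside W
  have hcount : ∑ y, (if y ∈ W then (0 : ℤ) else 1) = 3968 := by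
    have hpt : ∀ y, f y + f (y + x) = (if y ∈ W then (0 : ℤ) else 1)
        + (if y = 0 then 4 else 0) + (if y = x then 4 else 0) := by
      intro y
      by_cases h1 : y = 0
      · subst h1; rw [if_pos zW, if_pos rfl, if_neg (Ne.symm hx), zero_add, hf0, hfx]; norm_num
      · by_cases h2 : y = x
        · subst h2; rw [if_pos xW, if_neg h1, if_pos rfl, gg_add_self, hf0, hfx]; norm_num
        · rw [W_gen y h1 h2, if_neg h1, if_neg h2]; ring
    have := Finset.sum_congr (rfl : (univ : Finset GG) = univ) fun y _ => hpt y
    rw [Finset.sum_add_distrib, D.sum_f, sumshift, Finset.sum_add_distrib,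
      Finset.sum_add_distrib] at this
    simp only [Finset.sum_ite_eq', mem_univ, if_true] at this
    linarith
  have hcardW : ((univ.filter (· ∈ W)).card : ℤ) = 128 := by
    have h1 : ∑ y : GG, (if y ∈ W then (1 : ℤ) else 0) = ((univ.filter (· ∈ W)).card : ℤ) := by
      simp
    have h2 : ∑ y : GG, ((if y ∈ W then (0 : ℤ) else 1) + (if y ∈ W then (1 : ℤ) else 0)) = 4096 := by
      have : ∀ y : GG, ((if y ∈ W then (0 : ℤ) else 1) + (if y ∈ W then (1 : ℤ) else 0)) = 1 := by
        intro y; split_ifs <;> norm_num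
      simp_rw [this]
      rw [Finset.sum_const, Finset.card_univ, card_GG]; norm_num
    rw [Finset.sum_add_distrib, hcount] at h2
    linarith
  have ho0 : hat o 0 = 8192 := by rw [hato, zero_add, hv0, hvx]; norm_num
  have hox : hat o x = -8192 := by rw [hato, gg_add_self, hv0, hvx]; norm_num
  have ho2 : ∑ h, o h * o h = 1048576 := by
    have hp := parseval o o
    have hpt : ∀ y, hat o y * hat o y = 2 ^ 20 * (if y ∈ W then (0 : ℤ) else 1)
        + (if y = 0 then 2 ^ 26 else 0) + (if y = x then 2 ^ 26 else 0) := by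
      intro y
      by_cases h1 : y = 0
      · subst h1; rw [if_pos zW, if_pos rfl, if_neg (Ne.symm hx), ho0]; norm_num
      · by_cases h2 : y = x
        · subst h2; rw [if_pos xW, if_neg h1, if_pos rfl, hox]; norm_num
        · rw [← W_gen y h1 h2, if_neg h1, if_neg h2, hato, (hgen y h1 h2).1, (hgen y h1 h2).2]
          have h3 := hf1 y h1 h2
          have h4 := D.f_nonneg y
          have h5 := D.f_nonneg (y + x)
          generalize f y = k at *
          generalize f (y + x) = l at *
          have : k ≤ 1 := by omega
          have : l ≤ 1 := by omega
          interval_cases k <;> interval_cases l <;> first | omega | norm_num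
    simp_rw [hpt] at hp
    rw [Finset.sum_add_distrib, Finset.sum_add_distrib, ← Finset.mul_sum, hcount] at hp
    simp only [Finset.sum_ite_eq', mem_univ, if_true] at hp
    linarith
  have ho1 : ∑ h, o h = 8192 := by rw [← hat_zero, ho0]
  have hole : ∀ h, o h ≤ 128 := by
    intro h
    have e1 : ∑ y ∈ univ.filter (· ∈ W), hat o y * chi h y
        = ∑ h', o h' * ∑ y ∈ univ.filter (· ∈ W), chi (h' + h) y := by
      unfold hat
      simp_rw [Finset.sum_mul, Finset.mul_sum]
      rw [Finset.sum_comm]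
      exact Finset.sum_congr rfl fun a _ => Finset.sum_congr rfl fun y _ => by
        rw [chi_add_left]; ring
    have e2 : o h * 128 ≤ ∑ h', o h' * ∑ y ∈ univ.filter (· ∈ W), chi (h' + h) y := by
      have hnn : ∀ h' ∈ (univ : Finset GG),
          0 ≤ o h' * ∑ y ∈ univ.filter (· ∈ W), chi (h' + h) y := by
        intro h' _
        rw [sub_sum]
        refine mul_nonneg (onn _) ?_
        split_ifs <;> simp
      have := Finset.single_le_sum hnn (mem_univ h)
      refine le_trans (le_of_eq ?_) this
      rw [gg_add_self, sub_sum, if_pos (fun y _ => chi_zero_left y), hcardW]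
    have e3 : ∑ y ∈ univ.filter (· ∈ W), hat o y * chi h y = 8192 - 8192 * chi h x := by
      have hsub : ({0, x} : Finset GG) ⊆ univ.filter (· ∈ W) := by
        intro y hy
        simp only [mem_insert, mem_singleton] at hy
        rcases hy with rfl | rfl <;> simp [zW, xW]
      rw [← Finset.sum_subset hsub]
      · rw [Finset.sum_pair (Ne.symm hx), ho0, hox, chi_zero_right]; ring
      · intro y hy hn
        simp only [mem_filter, mem_univ, true_and] at hy
        simp only [mem_insert, mem_singleton, not_or] at hn
        have h3 := W_gen y hn.1 hn.2
        rw [if_pos hy] at h3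
        have := D.f_nonneg y
        have := D.f_nonneg (y + x)
        rw [hato, (hgen y hn.1 hn.2).1, (hgen y hn.1 hn.2).2]
        have a1 : f y = 0 := by omega
        have a2 : f (y + x) = 0 := by omega
        rw [a1, a2]; ring
    rw [← e1, e3] at e2
    rcases chi_cases h x with e | e <;> rw [e] at e2 <;> linarith
  have hoval : ∀ h, o h = 0 ∨ o h = 128 := by
    have hz : ∑ h, o h * (128 - o h) = 0 := by
      have : ∀ h, o h * (128 - o h) = 128 * o h - o h * o h := fun h => by ring
      simp_rw [this]
      rw [Finset.sum_sub_distrib, ← Finset.mul_sum, ho1, ho2]; norm_num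
    rw [Finset.sum_eq_zero_iff_of_nonneg
      (fun h _ => mul_nonneg (onn h) (by have := hole h; linarith))] at hz
    intro h
    rcases mul_eq_zero.mp (hz h (mem_univ h)) with e | e
    · exact Or.inl e
    · right; linarith
  obtain ⟨Y, hY⟩ := Submodule.exists_isCompl W
  have hcardY : ((univ.filter (· ∈ Y)).card : ℤ) = 32 := by
    have e := Submodule.prodEquivOfIsCompl W Y hY
    have h1 := Nat.card_congr e.toEquiv
    rw [Nat.card_prod, Nat.card_eq_fintype_card (α := GG), card_GG] at h1
    have hc : ∀ Z : Submodule (ZMod 2) GG, Nat.card Z = (univ.filter (· ∈ Z)).card := by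
      intro Z
      rw [Nat.card_eq_fintype_card, Fintype.card_subtype]
    rw [hc, hc] at h1
    have h2 : (univ.filter (· ∈ W)).card = 128 := by exact_mod_cast hcardW
    rw [h2] at h1
    have : (univ.filter (· ∈ Y)).card = 32 := by omega
    exact_mod_cast this
  have s1 : ∑ y ∈ univ.filter (· ∈ Y), hat v y
      = 19968 - 1024 * ∑ y ∈ univ.filter (· ∈ Y), f y := by
    simp_rw [D.hat_eq]
    rw [Finset.sum_sub_distrib, Finset.sum_add_distrib, ← Finset.mul_sum, Finset.sum_const,
      Finset.sum_ite_eq', if_pos (by simp), nsmul_eq_mul, hcardY]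
    norm_num
  have s2 : ∑ y ∈ univ.filter (· ∈ Y), hat v y
      = ∑ h, v h * ∑ y ∈ univ.filter (· ∈ Y), chi h y := by
    unfold hat
    simp_rw [Finset.mul_sum]
    rw [Finset.sum_comm]
  have s3 : (2048 : ℤ) ∣ ∑ h, v h * ∑ y ∈ univ.filter (· ∈ Y), chi h y := by
    refine Finset.dvd_sum fun h _ => ?_
    rw [sub_sum]
    split_ifs with hh
    · rw [hcardY]
      by_cases hvz : v h = 0
      · rw [hvz, zero_mul]; exact dvd_zero _
      rcases chi_cases h x with e | e
      · exfalso
        apply hvz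
        have hgne : g h ≠ 0 := by
          simp only [hg]; rw [e]; intro h0; apply hvz; linarith
        have hzero : h = 0 := by
          apply chi_nondeg
          intro z
          have hz : z ∈ W ⊔ Y := by rw [hY.sup_eq_top]; trivial
          obtain ⟨w, hw, y, hy, rfl⟩ := Submodule.mem_sup.mp hz
          rw [chi_add_right, hh y hy, (memW w).mp hw h hgne]; norm_num
        rw [hzero, D.v_zero]
      · have h64 := hoval h
        simp only [ho] at h64
        rw [e] at h64
        have : v h = 64 := by omega
        rw [this]; norm_num
    · rw [mul_zero]; exact dvd_zero _
  rw [← s2, s1] at s3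
  omega

theorem sum_decomp {f : GG → ℤ} (hf : ∑ x, f x = 1988) (p q r s : ℤ) :
    ∑ x, (p + q * f x + r * (if f x = 2 then 1 else 0) + s * (if f x = 3 then 1 else 0))
      = 4096 * p + 1988 * q + r * (∑ x, if f x = 2 then (1 : ℤ) else 0)
        + s * (∑ x, if f x = 3 then (1 : ℤ) else 0) := by
  rw [Finset.sum_add_distrib, Finset.sum_add_distrib, sum_affine hf, ← Finset.mul_sum,
    ← Finset.mul_sum]

theorem Dat.power_sum {v f : GG → ℤ} (D : Dat v f) (k : ℕ) :
    ∑ x, hat v x ^ k = 4096 * 496 ^ k + 1988 * ((-528) ^ k - 496 ^ k)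
      + ((-1552) ^ k - 2 * (-528) ^ k + 496 ^ k) * (∑ x, if f x = 2 then (1 : ℤ) else 0)
      + ((-2576) ^ k - 3 * (-528) ^ k + 2 * 496 ^ k) * (∑ x, if f x = 3 then (1 : ℤ) else 0)
      + ((4592 - 1024 * f 0) ^ k - (496 - 1024 * f 0) ^ k) := by
  rw [← sum_decomp D.sum_f]
  have key : ∀ x, (496 - 1024 * f x) ^ k = 496 ^ k + ((-528) ^ k - 496 ^ k) * f x
      + ((-1552) ^ k - 2 * (-528) ^ k + 496 ^ k) * (if f x = 2 then 1 else 0)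
      + ((-2576) ^ k - 3 * (-528) ^ k + 2 * 496 ^ k) * (if f x = 3 then 1 else 0) := by
    intro x
    have h1 : f x ≤ 3 := by
      by_cases hx : x = 0
      · subst hx; have := D.f0_le_one; omega
      · exact D.no_four x hx
    have h2 := D.f_nonneg x
    generalize f x = m at *
    interval_cases m <;> norm_num <;> ring
  refine sum_corr _ _ _ ?_ ?_
  · intro x hx
    rw [← key, D.hat_eq, if_neg hx, add_zero]
  · rw [← key, D.hat0]; ring

theorem Dat.exists_big {v f : GG → ℤ} (D : Dat v f) : ∃ a, 100 ≤ v a := by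
  by_contra hcon
  push Not at hcon
  have h2 : ∑ x, hat v x ^ 2 = 4096 * ∑ h, v h ^ 2 := by
    have := parseval v v
    simp_rw [← sq] at this; exact this
  have h3 := third v D.v_nonneg
  have h4 := fourth v D.v_nonneg
  have hv4 : ∑ h, v h ^ 4 ≤ 9801 * ∑ h, v h ^ 2 := by
    rw [Finset.mul_sum]
    refine Finset.sum_le_sum fun h _ => ?_
    have a1 := D.v_nonneg h
    have a2 : v h ≤ 99 := by have := hcon h; omega
    have a3 : v h ^ 2 ≤ 9801 := by nlinarith
    nlinarith [sq_nonneg (v h)]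
  rw [D.power_sum] at h2 h3 h4
  have d2 : 0 ≤ ∑ x, if f x = 2 then (1 : ℤ) else 0 :=
    Finset.sum_nonneg fun x _ => by split_ifs <;> norm_num
  have d3 : 0 ≤ ∑ x, if f x = 3 then (1 : ℤ) else 0 :=
    Finset.sum_nonneg fun x _ => by split_ifs <;> norm_num
  have f1 := D.f0_le_one
  have f2 := D.f_nonneg 0
  clear hcon
  generalize (∑ x, if f x = 2 then (1 : ℤ) else 0) = d at *
  generalize (∑ x, if f x = 3 then (1 : ℤ) else 0) = e at *
  generalize f 0 = z at *
  generalize (∑ h, v h ^ 4) = R at *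
  generalize (∑ h, v h ^ 2) = Q at *
  have e3 : e ≤ 3 := by interval_cases z <;> norm_num at h3 <;> omega
  have d18 : d ≤ 18 := by interval_cases z <;> norm_num at h3 <;> omega
  norm_num at h2 h3 h4
  interval_cases z <;> norm_num at h2 h3 h4 <;> interval_cases e <;> norm_num at h2 h3 h4 <;>
    interval_cases d <;> first
      | omega
      | (norm_num at h2 h4
         nlinarith [h2, h4, hv4])

/-- The third-moment polynomial. -/
def apoly (M z : ℤ) : ℤ := 2048 * (496 - M) ^ 3
      + (-(3 * 1024 * (496 - M) ^ 2) + 3 * 2 ^ 20 * (496 - M) - 2 ^ 30) * (996 - 2 * M)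
      + ((4592 - M - 1024 * z) ^ 3 - (496 - M - 1024 * z) ^ 3)

theorem apoly_neg : ∀ i : ℕ, i < 362 → apoly (100 + i) 0 < 0 ∧ apoly (100 + i) 1 < 0 := by
  intro i hi
  have h0 : (0:ℤ) ≤ i := by positivity
  have h1 : (i:ℤ) ≤ 361 := by omega
  generalize (i:ℤ) = x at *
  have h2 := mul_nonneg h0 (sub_nonneg.2 h1)
  unfold apoly
  constructor <;> nlinarith [mul_nonneg h0 h2, mul_nonneg h2 (sub_nonneg.2 h1)]

set_option maxHeartbeats 4000000 in
/-- The concluding numerical contradiction. -/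
theorem final_arith (M z E2 E3 E : ℤ) (ha : 100 ≤ M) (hM : 0 ≤ 996 - 2 * M)
    (z0 : 0 ≤ z) (z1 : z ≤ 1) (E32 : 3 * E2 ≤ E3) (Eall : E2 ≤ E)
    (A : 0 ≤ 2048 * (496 - M) ^ 3
      + (-(3 * 1024 * (496 - M) ^ 2) + 3 * 2 ^ 20 * (496 - M) - 2 ^ 30) * (996 - 2 * M)
      + 3 * 2 ^ 20 * (496 - M) * E2 - 2 ^ 30 * E3
      + ((4592 - M - 1024 * z) ^ 3 - (496 - M - 1024 * z) ^ 3))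
    (E2nn : 0 ≤ E2)
    (B : 4096 * 496 ^ 2 + 1988 * (528 ^ 2 - 496 ^ 2)
      + 2 ^ 20 * E + ((4592 - 1024 * z) ^ 2 - (496 - 1024 * z) ^ 2)
      ≤ 4096 * M ^ 2 + 2 * (2048 * (496 - M) ^ 2
      + (2 ^ 20 - 2048 * (496 - M)) * (996 - 2 * M) + 2 ^ 20 * E2
      + ((4592 - M - 1024 * z) ^ 2 - (496 - M - 1024 * z) ^ 2))) : False := by
  have hM498 : M ≤ 498 := by omega
  have A1 : 0 ≤ apoly M z := by
    unfold apoly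
    nlinarith [mul_nonneg (show 0 ≤ 528 + M by omega) E2nn]
  have hbig : 462 ≤ M := by
    by_contra hlt
    have := apoly_neg (M - 100).toNat (by omega)
    have hm : (100 : ℤ) + ((M - 100).toNat : ℤ) = M := by omega
    rw [hm] at this
    interval_cases z
    · omega
    · omega
  clear A1 ha
  interval_cases z <;> interval_cases M <;> norm_num at A B <;> omega

theorem Dat.final {v f : GG → ℤ} (D : Dat v f) : False := by
  obtain ⟨a, ha⟩ := D.exists_big
  have ha0 : a ≠ 0 := by
    rintro rfl; rw [D.v_zero] at ha; norm_num at ha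
  set M := v a with hM
  set H : Finset GG := univ.filter (fun x => chi a x = 1) with hH
  -- sums over H
  have sumH : ∀ F : GG → ℤ, 2 * ∑ x ∈ H, F x = ∑ x, (1 + chi a x) * F x := by
    intro F
    rw [hH, Finset.sum_filter, Finset.mul_sum]
    refine Finset.sum_congr rfl fun x _ => ?_
    rcases chi_cases a x with e | e <;> rw [e] <;> norm_num
  have cardH : (H.card : ℤ) = 2048 := by
    have := sumH (fun _ => 1)
    simp only [mul_one, Finset.sum_const, nsmul_eq_mul] at this
    rw [Finset.sum_add_distrib, sum_chi, if_neg ha0, Finset.sum_const, Finset.card_univ,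
      card_GG] at this
    norm_num at this
    linarith
  have zH : (0 : GG) ∈ H := by simp [hH, chi_zero_right]
  have hatH : ∑ x ∈ H, hat v x = 2048 * M := by
    have := sumH (fun x => hat v x)
    have h2 : ∀ x, (1 + chi a x) * hat v x = hat v x + hat v x * chi a x := fun x => by ring
    simp_rw [h2] at this
    rw [Finset.sum_add_distrib, sum_hat, sum_hat_chi, D.v_zero] at this
    linarith
  have fH : ∑ x ∈ H, f x = 996 - 2 * M := by
    simp_rw [D.hat_eq] at hatH
    rw [Finset.sum_sub_distrib, Finset.sum_add_distrib, ← Finset.mul_sum, Finset.sum_const,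
      Finset.sum_ite_eq', if_pos zH, nsmul_eq_mul, cardH] at hatH
    linarith
  -- corrected sums over H
  have corrH : ∀ k : ℕ, ∑ x ∈ H, (hat v x - M) ^ k
      = ∑ x ∈ H, (496 - M - 1024 * f x) ^ k
        + ((4592 - M - 1024 * f 0) ^ k - (496 - M - 1024 * f 0) ^ k) := by
    intro k
    have : ∀ x, (hat v x - M) ^ k = (496 - M - 1024 * f x) ^ k + (if x = 0 then
        ((4592 - M - 1024 * f 0) ^ k - (496 - M - 1024 * f 0) ^ k) else 0) := by
      intro x
      rw [D.hat_eq]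
      split_ifs with hx
      · subst hx; ring
      · ring
    simp_rw [this]
    rw [Finset.sum_add_distrib, Finset.sum_ite_eq', if_pos zH]
  -- projection
  set p : GG → ℤ := fun b => v b + v (b + a) - (if b = 0 then M else 0) - (if b = a then M else 0)
    with hp
  have pval : ∀ b, b ≠ 0 → b ≠ a → p b = v b + v (b + a) := by
    intro b h1 h2; simp only [hp]; rw [if_neg h1, if_neg h2]; ring
  have p0 : p 0 = 0 := by
    simp only [hp, if_true]; rw [if_neg (Ne.symm ha0), D.v_zero, zero_add, hM]; ring
  have pa : p a = 0 := by
    simp only [hp, if_true]; rw [if_neg ha0, gg_add_self, D.v_zero]; ring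
  have pnn : ∀ b, 0 ≤ p b := by
    intro b
    by_cases h1 : b = 0
    · rw [h1, p0]
    · by_cases h2 : b = a
      · rw [h2, pa]
      · rw [pval b h1 h2]; exact add_nonneg (D.v_nonneg _) (D.v_nonneg _)
  have hatp : ∀ x, hat p x = (1 + chi a x) * (hat v x - M) := by
    intro x
    have e1 : ∑ h, v (h + a) * chi h x = chi a x * hat v x := by
      unfold hat
      rw [Finset.mul_sum]
      refine Fintype.sum_equiv (Equiv.addRight a) _ _ ?_
      intro h
      simp only [Equiv.coe_addRight]
      rw [chi_add_left]
      linear_combination (- v (h + a) * chi h x) * chi_sq a x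
    have e2 : hat p x = ∑ h, (v h * chi h x + v (h + a) * chi h x
        - (if h = 0 then M * chi h x else 0) - (if h = a then M * chi h x else 0)) := by
      unfold hat
      refine Finset.sum_congr rfl fun h _ => ?_
      simp only [hp]
      split_ifs <;> ring
    rw [e2, Finset.sum_sub_distrib, Finset.sum_sub_distrib, Finset.sum_add_distrib, e1,
      Finset.sum_ite_eq', Finset.sum_ite_eq', if_pos (mem_univ _), if_pos (mem_univ _),
      chi_zero_left]
    unfold hat
    ring
  have hpow : ∀ k : ℕ, ∑ x, hat p x ^ (k + 1) = 2 ^ (k + 1) * ∑ x ∈ H, (hat v x - M) ^ (k + 1) := by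
    intro k
    rw [hH, Finset.sum_filter, Finset.mul_sum]
    refine Finset.sum_congr rfl fun x _ => ?_
    rw [hatp]
    rcases chi_cases a x with e | e <;> rw [e] <;> norm_num
    rw [mul_pow]
  have A : 0 ≤ ∑ x ∈ H, (hat v x - M) ^ 3 := by
    have := third p pnn
    rw [hpow 2] at this
    norm_num at this
    exact this
  have B : ∑ x, hat v x ^ 2 ≤ 4096 * M ^ 2 + 2 * ∑ x ∈ H, (hat v x - M) ^ 2 := by
    have q1 := parseval v v
    have q2 := parseval p p
    simp_rw [← sq] at q1 q2
    have q3 := hpow 1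
    norm_num at q3
    have q4 : 2 * ∑ h, v h ^ 2 ≤ 2 * M ^ 2 + ∑ h, p h ^ 2 := by
      have hsh : ∑ h, v (h + a) ^ 2 = ∑ h, v h ^ 2 :=
        Fintype.sum_equiv (Equiv.addRight a) _ _ fun s => rfl
      have hpt : ∀ h, v h ^ 2 + v (h + a) ^ 2 ≤ p h ^ 2 + (if h = 0 then M ^ 2 else 0)
          + (if h = a then M ^ 2 else 0) := by
        intro h
        by_cases h1 : h = 0
        · subst h1
          rw [p0, if_pos rfl, if_neg (Ne.symm ha0), D.v_zero, zero_add]; linarith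
        · by_cases h2 : h = a
          · subst h2
            rw [pa, if_neg h1, if_pos rfl, gg_add_self, D.v_zero]; linarith
          · rw [pval h h1 h2, if_neg h1, if_neg h2]
            nlinarith [mul_nonneg (D.v_nonneg h) (D.v_nonneg (h + a))]
      have := Finset.sum_le_sum (s := univ) fun h _ => hpt h
      rw [Finset.sum_add_distrib, hsh, Finset.sum_add_distrib, Finset.sum_add_distrib,
        Finset.sum_ite_eq', Finset.sum_ite_eq', if_pos (mem_univ _), if_pos (mem_univ _)] at this
      linarith
    linarith
  have fH0 : 0 ≤ ∑ x ∈ H, f x := Finset.sum_nonneg fun x _ => D.f_nonneg x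
  -- excesses
  set E2 := ∑ x ∈ H, (f x ^ 2 - f x) with hE2
  set E3 := ∑ x ∈ H, (f x ^ 3 - f x) with hE3
  have sqge : ∀ x, 0 ≤ f x ^ 2 - f x := by
    intro x; have := D.f_nonneg x
    rcases this.eq_or_lt with h | h
    · rw [← h]; norm_num
    · nlinarith
  have E2nn : 0 ≤ E2 := Finset.sum_nonneg fun x _ => sqge x
  have E32 : 3 * E2 ≤ E3 := by
    rw [hE2, hE3, Finset.mul_sum]
    refine Finset.sum_le_sum fun x _ => ?_
    have h1 : f x ≤ 3 := by
      by_cases hx : x = 0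
      · subst hx; have := D.f0_le_one; omega
      · exact D.no_four x hx
    have h2 := D.f_nonneg x
    generalize f x = m at *
    interval_cases m <;> norm_num
  have Eall : E2 ≤ ∑ x, (f x ^ 2 - f x) :=
    Finset.sum_le_sum_of_subset_of_nonneg (Finset.subset_univ _) fun x _ _ => sqge x
  have B2 : ∑ x, hat v x ^ 2 = 4096 * 496 ^ 2 + 1988 * (528 ^ 2 - 496 ^ 2)
      + 2 ^ 20 * (∑ x, (f x ^ 2 - f x)) + ((4592 - 1024 * f 0) ^ 2 - (496 - 1024 * f 0) ^ 2) := by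
    rw [← sum_affine D.sum_f, Finset.mul_sum, ← Finset.sum_add_distrib]
    refine sum_corr _ _ _ ?_ ?_
    · intro x hx; rw [D.hat_eq, if_neg hx]; ring
    · rw [D.hat0]; ring
  have affH : ∀ r s : ℤ, ∑ x ∈ H, (r + s * f x) = 2048 * r + s * (996 - 2 * M) := by
    intro r s
    rw [Finset.sum_add_distrib, ← Finset.mul_sum, fH, Finset.sum_const, nsmul_eq_mul, cardH]
  have C2 : ∑ x ∈ H, (496 - M - 1024 * f x) ^ 2 = 2048 * (496 - M) ^ 2
      + (2 ^ 20 - 2048 * (496 - M)) * (996 - 2 * M) + 2 ^ 20 * E2 := by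
    rw [← affH, hE2, Finset.mul_sum, ← Finset.sum_add_distrib]
    exact Finset.sum_congr rfl fun x _ => by ring
  have C3 : ∑ x ∈ H, (496 - M - 1024 * f x) ^ 3 = 2048 * (496 - M) ^ 3
      + (-(3 * 1024 * (496 - M) ^ 2) + 3 * 2 ^ 20 * (496 - M) - 2 ^ 30) * (996 - 2 * M)
      + 3 * 2 ^ 20 * (496 - M) * E2 - 2 ^ 30 * E3 := by
    rw [← affH, hE2, hE3, Finset.mul_sum, ← Finset.sum_add_distrib, Finset.mul_sum,
      ← Finset.sum_sub_distrib]
    exact Finset.sum_congr rfl fun x _ => by ring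
  rw [corrH 3, C3] at A
  rw [corrH 2, C2, B2] at B
  rw [fH] at fH0
  have f1 := D.f0_le_one
  have f2 := D.f_nonneg 0
  exact final_arith M (f 0) E2 E3 _ ha fH0 f2 f1 E32 Eall A E2nn B

theorem sum_chi_left (x : GG) : ∑ h, chi h x = if x = 0 then 4096 else 0 := by
  simp_rw [chi_comm _ x]; exact sum_chi x

/-- weight of the codeword attached to `h` by a list of columns -/
def wt {ι : Type*} [Fintype ι] (col : ι → GG) (h : GG) : ℕ := (univ.filter fun i => h ⬝ᵥ col i ≠ 0).card

theorem wt_chi {ι : Type*} [Fintype ι] [DecidableEq ι] (hι : Fintype.card ι = 1988) (col : ι → GG) (h : GG) :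
    2 * (wt col h : ℤ) = 1988 - ∑ i, chi h (col i) := by
  have h1 : (wt col h : ℤ) = ∑ i, (if h ⬝ᵥ col i ≠ 0 then (1 : ℤ) else 0) := by
    unfold wt; rw [Finset.card_filter]; push_cast; rfl
  have h2 : ∀ i, chi h (col i) = 1 - 2 * (if h ⬝ᵥ col i ≠ 0 then (1 : ℤ) else 0) := by
    intro i; unfold chi sg
    by_cases e : h ⬝ᵥ col i = 0 <;> simp [e]
  simp_rw [h2]
  rw [Finset.sum_sub_distrib, ← Finset.mul_sum, ← h1, Finset.sum_const, Finset.card_univ, hι]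
  simp

theorem no_even_code {ι : Type*} [Fintype ι] [DecidableEq ι] (hι : Fintype.card ι = 1988) 
    (col : ι → GG) (hw : ∀ h, h ≠ 0 → 992 ≤ wt col h)
    (he : ∀ h, Even (wt col h)) : False := by
  have hex : ∀ h, ∃ k : ℤ, (wt col h : ℤ) = 992 + 2 * k := by
    intro h
    obtain ⟨r, hr⟩ := he h
    exact ⟨r - 496, by rw [hr]; push_cast; ring⟩
  choose k hk using hex
  have k0 : k 0 = -496 := by
    have h1 := hk 0
    have : wt col 0 = 0 := by unfold wt; simp
    rw [this] at h1; push_cast at h1; omega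
  have hk4 : ∀ h, 4 * k h = 4 - ∑ i, chi h (col i) := by
    intro h; have := wt_chi hι col h; rw [hk h] at this; linarith
  have hatk : ∀ x, hat k x = (if x = 0 then 4096 else 0)
      - 1024 * ∑ i, (if col i = x then (1 : ℤ) else 0) := by
    intro x
    have h4 : 4 * hat k x = 4 * (if x = 0 then 4096 else 0)
        - 4096 * ∑ i, (if col i = x then (1 : ℤ) else 0) := by
      unfold hat
      rw [Finset.mul_sum]
      have e1 : ∀ h, 4 * (k h * chi h x) = 4 * chi h x - ∑ i, chi h (col i + x) := by
        intro h
        have : ∑ i, chi h (col i + x) = (∑ i, chi h (col i)) * chi h x := by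
          rw [Finset.sum_mul]
          exact Finset.sum_congr rfl fun i _ => chi_add_right _ _ _
        rw [this]
        linear_combination chi h x * hk4 h
      simp_rw [e1]
      rw [Finset.sum_sub_distrib, ← Finset.mul_sum, sum_chi_left, Finset.sum_comm, Finset.mul_sum]
      refine congrArg₂ _ rfl (Finset.sum_congr rfl fun i _ => ?_)
      rw [sum_chi_left]
      by_cases e : col i = x
      · rw [if_pos e, e, if_pos (gg_add_self x)]; norm_num
      · rw [if_neg e, if_neg (fun h => e (gg_add_eq_zero h))]; norm_num
    linarith
  have D : Dat (fun h => if h = 0 then 0 else k h)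
      (fun x => ∑ i, (if col i = x then (1 : ℤ) else 0)) :=
    { v_nonneg := by
        intro h
        split_ifs with hh
        · exact le_rfl
        · have h1 := hw h hh
          have h2 := hk h
          omega
      v_zero := by simp
      f_nonneg := fun x => Finset.sum_nonneg fun i _ => by split_ifs <;> norm_num
      hat_eq := by
        intro x
        have : hat (fun h => if h = 0 then 0 else k h) x = hat k x + 496 := by
          have e1 : ∀ h, k h * chi h x
              = (if h = 0 then 0 else k h) * chi h x + (if h = 0 then -496 else 0) := by
            intro h
            split_ifs with hh
            · rw [hh, k0, chi_zero_left]; ring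
            · ring
          unfold hat
          rw [Finset.sum_congr (rfl : (univ : Finset GG) = univ) fun h _ => e1 h]
          rw [Finset.sum_add_distrib, Finset.sum_ite_eq', if_pos (mem_univ _)]
          ring
        rw [this, hatk]; ring }
  exact D.final

theorem wt_cast {ι : Type*} [Fintype ι] [DecidableEq ι] (col : ι → GG) (h : GG) :
    (wt col h : ZMod 2) = ∑ i, h ⬝ᵥ col i := by
  have h1 : (wt col h : ZMod 2) = ∑ i, (if h ⬝ᵥ col i ≠ 0 then (1 : ZMod 2) else 0) := by
    unfold wt; rw [Finset.card_filter]; push_cast; rfl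
  rw [h1]
  refine Finset.sum_congr rfl fun i _ => ?_
  generalize h ⬝ᵥ col i = z
  revert z; decide

theorem no_code {ι : Type*} [Fintype ι] [DecidableEq ι] (hι : Fintype.card ι = 1988) (i0 : ι)
    (col : ι → GG) (hw : ∀ h, h ≠ 0 → 992 ≤ wt col h) : False := by
  set col' : ι → GG := Function.update col i0 (∑ i ∈ univ.erase i0, col i) with hc
  have hne : ∀ i, i ≠ i0 → col' i = col i := fun i hi => by rw [hc, Function.update_of_ne hi]
  have h0 : col' i0 = ∑ i ∈ univ.erase i0, col i := by rw [hc, Function.update_self]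
  have heven : ∀ h, Even (wt col' h) := by
    intro h
    rw [← ZMod.natCast_eq_zero_iff_even, wt_cast, ← dotProduct_sum,
      ← Finset.add_sum_erase _ _ (mem_univ i0), h0,
      Finset.sum_congr rfl (fun i hi => hne i (Finset.ne_of_mem_erase hi)), gg_add_self,
      dotProduct_zero]
  refine no_even_code hι col' ?_ heven
  intro h hh
  have h1 := hw h hh
  have h2 : wt col h ≤ wt col' h + 1 := by
    unfold wt
    refine le_trans (Finset.card_le_card (t := insert i0 (univ.filter fun i => h ⬝ᵥ col' i ≠ 0)) ?_)
      (Finset.card_insert_le _ _)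
    intro i hi
    simp only [mem_filter, mem_univ, true_and, mem_insert] at hi ⊢
    by_cases e : i = i0
    · exact Or.inl e
    · right; rw [hne i e]; exact hi
  obtain ⟨r, hr⟩ := heven h
  omega

theorem exists_low {ι : Type*} [Fintype ι] [DecidableEq ι] (hι : Fintype.card ι = 1988) (i0 : ι)
    (C : Submodule (ZMod 2) (ι → ZMod 2))
    (hdim : Module.finrank (ZMod 2) C = 12) :
    ∃ c ∈ C, c ≠ 0 ∧ hammingNorm c ≤ 991 := by
  by_contra hcon
  push Not at hcon
  let b := Module.finBasisOfFinrankEq (ZMod 2) C hdim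
  refine no_code hι i0 (fun i j => (b j : ι → ZMod 2) i) ?_
  intro h hh
  have hval : ∀ i, ((b.equivFun.symm h : C) : ι → ZMod 2) i
      = h ⬝ᵥ (fun j => (b j : ι → ZMod 2) i) := by
    intro i
    rw [Module.Basis.equivFun_symm_apply]
    simp [dotProduct]
  have hn := hcon (b.equivFun.symm h : C) (b.equivFun.symm h).2 (by
    intro h0
    apply hh
    have : b.equivFun.symm h = 0 := Subtype.ext h0
    exact (LinearEquiv.map_eq_zero_iff _).mp this)
  have : hammingNorm ((b.equivFun.symm h : C) : ι → ZMod 2)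
      = wt (fun i j => (b j : ι → ZMod 2) i) h := by
    unfold hammingNorm wt
    refine congrArg Finset.card (Finset.filter_congr fun i _ => ?_)
    rw [hval]
  omega

/-- There is no binary linear [1988, 12, 992] code: every `ZMod 2`-linear subspace of
`Fin 1988 → ZMod 2` of dimension 12 contains a nonzero codeword of Hamming weight
at most 991. -/
theorem no_binary_linear_code_1988_12_992
    (C : Submodule (ZMod 2) (Fin 1988 → ZMod 2))
    (hdim : Module.finrank (ZMod 2) C = 12) :
    ∃ c ∈ C, c ≠ 0 ∧ hammingNorm c ≤ 991 := by
  exact exists_low (Fintype.card_fin 1988) 0 C hdim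
end

section
/- There is no binary linear [356, 10, 176] code. Equivalently: every F₂-linear subspace C of F₂^356 of dimension 10 contains a nonzero codeword of Hamming weight at most 175. -/
namespace Code356

/-- `VanishMod N r f`: every `r`-fold iterated difference of `f` is divisible by `N`. -/
def VanishMod {m : ℕ} (N : ℤ) : ℕ → ((Fin m → ZMod 2) → ℤ) → Prop
  | 0, f => ∀ x, N ∣ f x
  | r + 1, f => ∀ v, VanishMod N r (fun x => f x + f (x + v))

lemma VanishMod.add {m : ℕ} {N : ℤ} {r : ℕ} {f g : (Fin m → ZMod 2) → ℤ}
    (hf : VanishMod N r f) (hg : VanishMod N r g) : VanishMod N r (fun x => f x + g x) := by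
  induction r generalizing f g with
  | zero => exact fun x => dvd_add (hf x) (hg x)
  | succ r ih =>
    intro v
    have := ih (hf v) (hg v)
    convert this using 2
    ring

lemma VanishMod.sum {m : ℕ} {N : ℤ} {r : ℕ} {ι : Type*} (s : Finset ι)
    {f : ι → (Fin m → ZMod 2) → ℤ}
    (hf : ∀ i ∈ s, VanishMod N r (f i)) : VanishMod N r (fun x => ∑ i ∈ s, f i x) := by
  classical
  induction s using Finset.induction_on with
  | empty =>
    simp only [Finset.sum_empty]
    clear hf
    induction r with
    | zero => exact fun x => dvd_zero _
    | succ r ih => intro v; simpa using ih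
  | insert a s ha ih =>
    simp only [Finset.sum_insert ha]
    exact (hf a (by simp)).add (ih fun i hi => hf i (by simp [hi]))

lemma vanishMod_const {m : ℕ} (r : ℕ) (N a : ℤ) (h : N ∣ 2 ^ r * a) :
    VanishMod (m := m) N r (fun _ => a) := by
  induction r generalizing a with
  | zero => intro x; simpa using h
  | succ r ih =>
    intro v
    apply ih
    convert h using 1
    ring

lemma VanishMod.div {m : ℕ} {r : ℕ} {M N : ℤ} (hM : M ≠ 0) {f : (Fin m → ZMod 2) → ℤ}
    (hf : VanishMod (M * N) r (fun x => M * f x)) : VanishMod N r f := by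
  induction r generalizing f with
  | zero => exact fun x => (mul_dvd_mul_iff_left hM).1 (hf x)
  | succ r ih =>
    intro v
    apply ih
    convert hf v using 2
    ring

lemma VanishMod.slice {m : ℕ} {N : ℤ} {r : ℕ} {f : (Fin (m + 1) → ZMod 2) → ℤ}
    (hf : VanishMod N r f) (a : ZMod 2) :
    VanishMod N r (fun x : Fin m → ZMod 2 => f (Fin.cons a x)) := by
  induction r generalizing f with
  | zero => exact fun x => hf _
  | succ r ih =>
    intro v
    have := ih (hf (Fin.cons 0 v))
    have e : ∀ x : Fin m → ZMod 2,
        (Fin.cons a (x + v) : Fin (m + 1) → ZMod 2) = Fin.cons a x + Fin.cons 0 v := by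
      intro x
      funext j
      refine Fin.cases ?_ (fun j => ?_) j <;> simp
    simp only [e]
    exact this

/-- A binary function of degree at most `r` which is not zero has at least `2 ^ (m - r)` ones. -/
lemma odd_count {m r : ℕ} {f : (Fin m → ZMod 2) → ℤ} (hr : r ≤ m)
    (hf : VanishMod 2 (r + 1) f) (hne : ∃ x, ¬ (2 : ℤ) ∣ f x) :
    2 ^ (m - r) ≤ (Finset.univ.filter (fun x => ¬ (2 : ℤ) ∣ f x)).card := by
  induction m generalizing r with
  | zero =>
    obtain ⟨x, hx⟩ := hne
    simp only [Nat.zero_sub, pow_zero]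
    exact Finset.card_pos.2 ⟨x, Finset.mem_filter.2 ⟨Finset.mem_univ _, hx⟩⟩
  | succ m ih =>
    have key : (Finset.univ.filter (fun x => ¬ (2 : ℤ) ∣ f x)).card
        = (Finset.univ.filter (fun x : Fin m → ZMod 2 => ¬ (2 : ℤ) ∣ f (Fin.cons 0 x))).card
        + (Finset.univ.filter (fun x : Fin m → ZMod 2 => ¬ (2 : ℤ) ∣ f (Fin.cons 1 x))).card := by
      simp only [Finset.card_filter]
      rw [← (Fin.consEquiv (fun _ : Fin (m + 1) => ZMod 2)).sum_comp, Fintype.sum_prod_type]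
      exact Fin.sum_univ_two _
    have hsum : VanishMod 2 r
        (fun x : Fin m → ZMod 2 => f (Fin.cons 0 x) + f (Fin.cons 1 x)) := by
      have h1 := VanishMod.slice (hf (Fin.cons 1 0)) 0
      convert h1 using 3
      congr 1
      funext j
      refine Fin.cases ?_ (fun j => ?_) j <;> simp
    have h0 := hf.slice 0
    have h1 := hf.slice 1
    have hex : (∃ x : Fin m → ZMod 2, ¬ (2 : ℤ) ∣ f (Fin.cons 0 x)) ∨
        (∃ x : Fin m → ZMod 2, ¬ (2 : ℤ) ∣ f (Fin.cons 1 x)) := by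
      obtain ⟨x, hx⟩ := hne
      rw [← Fin.cons_self_tail x] at hx
      rcases (show ∀ a : ZMod 2, a = 0 ∨ a = 1 by decide) (x 0) with h | h
      · left; exact ⟨_, by rwa [h] at hx⟩
      · right; exact ⟨_, by rwa [h] at hx⟩
    rw [key]
    -- if one slice is even everywhere, the other one has smaller degree
    have one : ∀ a b : ZMod 2,
        (∃ x : Fin m → ZMod 2, ¬ (2 : ℤ) ∣ f (Fin.cons a x)) →
        (¬ ∃ x : Fin m → ZMod 2, ¬ (2 : ℤ) ∣ f (Fin.cons b x)) →
        VanishMod 2 (r + 1) (fun x : Fin m → ZMod 2 => f (Fin.cons a x)) →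
        VanishMod 2 r
          (fun x : Fin m → ZMod 2 => f (Fin.cons b x) + f (Fin.cons a x)) →
        2 ^ (m + 1 - r) ≤
          (Finset.univ.filter (fun x : Fin m → ZMod 2 => ¬ (2 : ℤ) ∣ f (Fin.cons a x))).card := by
      intro a b hx hno _ hs
      push Not at hno
      have hiff : ∀ x : Fin m → ZMod 2, (¬ (2 : ℤ) ∣ f (Fin.cons b x) + f (Fin.cons a x)) ↔
          ¬ (2 : ℤ) ∣ f (Fin.cons a x) := fun x => by rw [dvd_add_right (hno x)]
      have hx' : ∃ x : Fin m → ZMod 2, ¬ (2 : ℤ) ∣ f (Fin.cons b x) + f (Fin.cons a x) := by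
        obtain ⟨x, hx⟩ := hx
        exact ⟨x, (hiff x).2 hx⟩
      cases r with
      | zero =>
        obtain ⟨x, hx⟩ := hx'
        exact absurd (hs x) hx
      | succ r =>
        have := ih (r := r) (by omega) hs hx'
        simp only [hiff] at this
        rwa [show m + 1 - (r + 1) = m - r by omega]
    by_cases e0 : ∃ x : Fin m → ZMod 2, ¬ (2 : ℤ) ∣ f (Fin.cons 0 x)
    · by_cases e1 : ∃ x : Fin m → ZMod 2, ¬ (2 : ℤ) ∣ f (Fin.cons 1 x)
      · by_cases hrm : r ≤ m
        · have a0 := ih hrm h0 e0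
          have a1 := ih hrm h1 e1
          rw [show m + 1 - r = (m - r) + 1 by omega, pow_succ]
          omega
        · rw [show m + 1 - r = 0 by omega, pow_zero]
          obtain ⟨x, hx⟩ := e0
          have : 0 < (Finset.univ.filter
              (fun x : Fin m → ZMod 2 => ¬ (2 : ℤ) ∣ f (Fin.cons 0 x))).card :=
            Finset.card_pos.2 ⟨x, by simpa using hx⟩
          omega
      · have := one 0 1 e0 e1 h0 (by simpa only [add_comm] using hsum)
        omega
    · have e1 := hex.resolve_left e0
      have := one 1 0 e1 e0 h1 hsum
      omega

/-- The indicator of a nonzero bit, as an integer. -/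
def bit (a : ZMod 2) : ℤ := if a = 0 then 0 else 1

/-- The sign character of `ZMod 2`. -/
def sg (a : ZMod 2) : ℤ := if a = 0 then 1 else -1

lemma sg_add (a b : ZMod 2) : sg (a + b) = sg a * sg b := by
  revert a b; decide

lemma sg_sq (a : ZMod 2) : sg a * sg a = 1 := by
  revert a; decide

lemma sg_bit (a : ZMod 2) : sg a = 1 - 2 * bit a := by
  revert a; decide

lemma vanishMod_bit {m : ℕ} (c : Fin m → ZMod 2) (r : ℕ) :
    VanishMod (2 ^ r) (r + 1) (fun h => bit (h ⬝ᵥ c)) := by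
  have gen : ∀ (r : ℕ) (a : ℤ),
      VanishMod (2 ^ r * a) (r + 1) (fun h => a * bit (h ⬝ᵥ c)) := by
    intro r
    induction r with
    | zero =>
      intro a v x
      simp only [pow_zero, one_mul]
      exact dvd_add (dvd_mul_right _ _) (dvd_mul_right _ _)
    | succ r ih =>
      intro a v
      rcases (show ∀ a : ZMod 2, a = 0 ∨ a = 1 by decide) (v ⬝ᵥ c) with h | h
      · have := ih (2 * a)
        have e : (fun x : Fin m → ZMod 2 => a * bit (x ⬝ᵥ c) + a * bit ((x + v) ⬝ᵥ c))
            = fun x => 2 * a * bit (x ⬝ᵥ c) := by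
          funext x
          rw [add_dotProduct, h, add_zero]; ring
        simp only [e]
        rwa [show (2 : ℤ) ^ (r + 1) * a = 2 ^ r * (2 * a) by ring]
      · have : VanishMod (m := m) (2 ^ (r + 1) * a) (r + 1) (fun _ => a) :=
          vanishMod_const _ _ _ dvd_rfl
        have hb : ∀ b : ZMod 2, bit b + bit (b + 1) = 1 := by decide
        have e : (fun x : Fin m → ZMod 2 => a * bit (x ⬝ᵥ c) + a * bit ((x + v) ⬝ᵥ c))
            = fun x => a := by
          funext x
          rw [add_dotProduct, h, ← mul_add, hb, mul_one]
        simp only [e]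
        exact this
  simpa using gen r 1

/-- Orthogonality of characters. -/
lemma sum_sg (c : Fin 10 → ZMod 2) :
    ∑ h : Fin 10 → ZMod 2, sg (h ⬝ᵥ c) = if c = 0 then 1024 else 0 := by
  split_ifs with hc
  · subst hc
    simp [sg, ZMod.card]
  · obtain ⟨j, hj⟩ := Function.ne_iff.1 hc
    have hj1 : c j = 1 := by
      have : ∀ a : ZMod 2, a ≠ 0 → a = 1 := by decide
      exact this _ hj
    have h1 := Equiv.sum_comp (Equiv.addRight (Pi.single j (1 : ZMod 2) : Fin 10 → ZMod 2))
      (fun h => sg (h ⬝ᵥ c))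
    simp only [Equiv.coe_addRight, add_dotProduct, single_dotProduct, hj1, sg_add, mul_one,
      ← Finset.sum_mul] at h1
    have : sg 1 = -1 := by decide
    rw [this] at h1
    linarith

lemma sum_sg_mul (c d : Fin 10 → ZMod 2) :
    ∑ h : Fin 10 → ZMod 2, sg (h ⬝ᵥ c) * sg (h ⬝ᵥ d) = if c = d then 1024 else 0 := by
  have h2 : c + d = 0 ↔ c = d := by
    rw [← CharTwo.sub_eq_add, sub_eq_zero]
  simp only [← sg_add, ← dotProduct_add, sum_sg, h2]


section core

variable (c : Fin 356 → Fin 10 → ZMod 2)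

/-- Sum of the signs of the codeword with message `h`. -/
def A (h : Fin 10 → ZMod 2) : ℤ := ∑ i, sg (h ⬝ᵥ c i)

/-- Weight of the codeword with message `h`. -/
def W (h : Fin 10 → ZMod 2) : ℤ := ∑ i, bit (h ⬝ᵥ c i)

/-- Contribution of the ordered pairs of repeated columns. -/
def E (h : Fin 10 → ZMod 2) : ℤ :=
  ∑ i, ∑ j, if i ≠ j ∧ c i = c j then sg (h ⬝ᵥ c i) else 0

/-- Number of ordered pairs of repeated columns. -/
def N : ℤ := ∑ i, ∑ j, if i ≠ j ∧ c i = c j then 1 else 0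

/-- Excess of the weight over 176 (set to 0 at the zero message). -/
def y (h : Fin 10 → ZMod 2) : ℤ := W c h - 176 + if h = 0 then 176 else 0

lemma A_W (h : Fin 10 → ZMod 2) : A c h = 356 - 2 * W c h := by
  simp [A, W, sg_bit, Finset.sum_sub_distrib, Finset.mul_sum]

lemma two_y (h : Fin 10 → ZMod 2) :
    2 * y c h = 4 - A c h + if h = 0 then 352 else 0 := by
  rw [A_W, y]
  split_ifs <;> ring

lemma A_zero : A c 0 = 356 := by simp [A, sg]

lemma E_zero : E c 0 = N c := by simp [E, N, sg]

lemma y_zero : y c 0 = 0 := by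
  have := two_y c 0
  rw [A_zero] at this
  simp at this
  exact this

lemma abs_sg (a : ZMod 2) : |sg a| = 1 := by revert a; decide

lemma abs_E (h : Fin 10 → ZMod 2) : |E c h| ≤ N c := by
  unfold E N
  refine (Finset.abs_sum_le_sum_abs _ _).trans (Finset.sum_le_sum fun i _ => ?_)
  refine (Finset.abs_sum_le_sum_abs _ _).trans (Finset.sum_le_sum fun j _ => ?_)
  split_ifs
  · rw [abs_sg]
  · simp

lemma sum_A (hc : ∀ i, c i ≠ 0) : ∑ h, A c h = 0 := by
  unfold A
  rw [Finset.sum_comm]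
  simp [sum_sg, hc]

lemma A_add_E (k : Fin 10 → ZMod 2) :
    A c k + E c k = ∑ i, ∑ j, if c i = c j then sg (k ⬝ᵥ c j) else 0 := by
  unfold A E
  rw [← Finset.sum_add_distrib]
  refine Finset.sum_congr rfl fun i _ => ?_
  have : sg (k ⬝ᵥ c i) = ∑ j, if i = j then sg (k ⬝ᵥ c i) else 0 := by simp
  rw [this, ← Finset.sum_add_distrib]
  refine Finset.sum_congr rfl fun j _ => ?_
  by_cases hij : i = j
  · subst hij; simp
  · by_cases h : c i = c j
    · simp [hij, h]
    · simp [hij, h]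

lemma sum_AA (k : Fin 10 → ZMod 2) :
    ∑ h, A c h * A c (h + k) = 1024 * (A c k + E c k) := by
  rw [A_add_E]
  simp only [A, Finset.sum_mul_sum]
  rw [Finset.sum_comm, Finset.mul_sum]
  refine Finset.sum_congr rfl fun i _ => ?_
  rw [Finset.sum_comm, Finset.mul_sum]
  refine Finset.sum_congr rfl fun j _ => ?_
  have : ∀ h : Fin 10 → ZMod 2, sg (h ⬝ᵥ c i) * sg ((h + k) ⬝ᵥ c j)
      = sg (h ⬝ᵥ c i) * sg (h ⬝ᵥ c j) * sg (k ⬝ᵥ c j) := by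
    intro h
    rw [add_dotProduct, sg_add]; ring
  simp only [this]
  rw [← Finset.sum_mul, sum_sg_mul]
  split_ifs <;> simp

lemma sum_y (hc : ∀ i, c i ≠ 0) : ∑ h, y c h = 2224 := by
  have h2 : ∑ h, 2 * y c h = 4448 := by
    simp only [two_y, Finset.sum_add_distrib, Finset.sum_sub_distrib, sum_A c hc]
    simp [ZMod.card]
  rw [← Finset.mul_sum] at h2
  linarith

/-- Autocorrelation of `y`. -/
lemma sum_yy (hc : ∀ i, c i ≠ 0) (k : Fin 10 → ZMod 2) :
    4 * ∑ h, y c h * y c (h + k) = 16384 + 1024 * (A c k + E c k) + 704 * (4 - A c k)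
      + if k = 0 then 123904 else 0 := by
  have hs : ∀ h, 4 * (y c h * y c (h + k)) = 16 - 4 * A c h - 4 * A c (h + k)
      + A c h * A c (h + k) + (if h = 0 then 352 * (4 - A c (h + k)) else 0)
      + (if h = k then 352 * (4 - A c h) else 0)
      + (if h = 0 then (if k = 0 then 123904 else 0) else 0) := by
    intro h
    have hk : h + k = 0 ↔ h = k := by rw [← CharTwo.sub_eq_add, sub_eq_zero]
    have e : 4 * (y c h * y c (h + k)) = (2 * y c h) * (2 * y c (h + k)) := by ring
    rw [e, two_y, two_y]
    simp only [hk]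
    by_cases h0 : h = 0
    · by_cases hk' : h = k
      · have : k = 0 := by rw [← hk', h0]
        simp [h0, this]; ring
      · have : k ≠ 0 := fun h' => hk' (by rw [h0, h'])
        simp [h0, this, Ne.symm this]; ring
    · by_cases hk' : h = k
      · have : k ≠ 0 := fun h' => h0 (by rw [hk', h'])
        simp [hk', this]; ring
      · simp [h0, hk']; ring
  have hshift : ∑ h, A c (h + k) = 0 := by
    have := Equiv.sum_comp (Equiv.addRight k) (fun h => A c h)
    simp only [Equiv.coe_addRight] at this
    rw [this, sum_A c hc]
  rw [Finset.mul_sum]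
  simp only [hs, Finset.sum_add_distrib, Finset.sum_sub_distrib, ← Finset.mul_sum, sum_A c hc,
    hshift, sum_AA]
  simp [ZMod.card]
  ring

lemma sum_y_sq (hc : ∀ i, c i ≠ 0) : ∑ h, y c h * y c h = 64256 + 256 * N c := by
  have := sum_yy c hc 0
  rw [A_zero, E_zero] at this
  simp only [add_zero, if_true] at this
  linarith

lemma corr_nonneg (hc : ∀ i, c i ≠ 0) (hy : ∀ h, 0 ≤ y c h) (k : Fin 10 → ZMod 2) (hk : k ≠ 0) :
    0 ≤ 160 - 5 * y c k + 8 * E c k := by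
  have h1 := sum_yy c hc k
  have h2 := two_y c k
  simp only [hk, if_false, add_zero] at h1 h2
  have h3 : 0 ≤ ∑ h, y c h * y c (h + k) :=
    Finset.sum_nonneg fun h _ => mul_nonneg (hy _) (hy _)
  linarith

lemma sum_y_sg (hc : ∀ i, c i ≠ 0) (i : Fin 356) :
    2 * ∑ h, y c h * sg (h ⬝ᵥ c i) = 352 - 1024 * ∑ j, if c j = c i then 1 else 0 := by
  have e : ∀ h, 2 * (y c h * sg (h ⬝ᵥ c i)) = 4 * sg (h ⬝ᵥ c i) - A c h * sg (h ⬝ᵥ c i)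
      + if h = 0 then 352 else 0 := by
    intro h
    rw [← mul_assoc, two_y]
    by_cases h0 : h = 0
    · simp [h0, sg]
    · simp [h0]; ring
  have hA : ∑ h, A c h * sg (h ⬝ᵥ c i) = 1024 * ∑ j, if c j = c i then 1 else 0 := by
    simp only [A, Finset.sum_mul]
    rw [Finset.sum_comm, Finset.mul_sum]
    refine Finset.sum_congr rfl fun j _ => ?_
    rw [sum_sg_mul]
    split_ifs <;> simp
  rw [Finset.mul_sum]
  simp only [e, Finset.sum_add_distrib, Finset.sum_sub_distrib, hA, ← Finset.mul_sum, sum_sg]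
  simp [hc]
  ring

lemma sum_y_E (hc : ∀ i, c i ≠ 0) : ∑ h, y c h * E c h ≤ -848 * N c := by
  have e : ∑ h, y c h * E c h
      = ∑ i, ∑ j, if i ≠ j ∧ c i = c j then ∑ h, y c h * sg (h ⬝ᵥ c i) else 0 := by
    simp only [E, Finset.mul_sum]
    rw [Finset.sum_comm]
    refine Finset.sum_congr rfl fun i _ => ?_
    rw [Finset.sum_comm]
    refine Finset.sum_congr rfl fun j _ => ?_
    split_ifs <;> simp
  rw [e, N, Finset.mul_sum]
  refine Finset.sum_le_sum fun i _ => ?_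
  rw [Finset.mul_sum]
  refine Finset.sum_le_sum fun j _ => ?_
  split_ifs with hij
  · have h1 := sum_y_sg c hc i
    have h2 : (2 : ℤ) ≤ ∑ l, if c l = c i then 1 else 0 := by
      have : ∑ l ∈ ({i, j} : Finset (Fin 356)), (if c l = c i then (1 : ℤ) else 0)
          ≤ ∑ l, if c l = c i then 1 else 0 :=
        Finset.sum_le_sum_of_subset_of_nonneg (Finset.subset_univ _)
          (fun l _ _ => by split_ifs <;> simp)
      rw [Finset.sum_pair hij.1] at this
      simpa [hij.2.symm] using this
    linarith
  · simp

/-- The nonnegative quantity `y (160 - 5 y + 8 E)` has a small sum. -/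
lemma sum_f (hc : ∀ i, c i ≠ 0) :
    ∑ h, y c h * (160 - 5 * y c h + 8 * E c h) ≤ 34560 - 8064 * N c := by
  have e : ∀ h, y c h * (160 - 5 * y c h + 8 * E c h)
      = 160 * y c h - 5 * (y c h * y c h) + 8 * (y c h * E c h) := fun h => by ring
  simp only [e, Finset.sum_add_distrib, Finset.sum_sub_distrib, ← Finset.mul_sum, sum_y c hc,
    sum_y_sq c hc]
  have := sum_y_E c hc
  linarith

lemma vanish_W (e : ℕ) (a : ℤ) : VanishMod (2 ^ (e + 1)) (e + 2) (fun h => W c h + a) := by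
  unfold W
  refine VanishMod.add (VanishMod.sum _ fun i _ => vanishMod_bit _ _) (vanishMod_const _ _ _ ?_)
  exact Dvd.intro (2 * a) (by ring)

/-- If all weights are divisible by `2 ^ e` but some is not divisible by `2 ^ (e + 1)`, then
many weights are not divisible by `2 ^ (e + 1)` (with weights shifted by 176). -/
lemma many (e : ℕ) (he : e ≤ 8) (hdiv : ∀ h, (2 : ℤ) ^ e ∣ W c h - 176)
    (hne : ∃ h, ¬ (2 : ℤ) ^ (e + 1) ∣ W c h - 176) :
    2 ^ (9 - e) ≤ (Finset.univ.filter (fun h => ¬ (2 : ℤ) ^ (e + 1) ∣ W c h - 176)).card := by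
  choose g hg using hdiv
  have hv := vanish_W c e (-176)
  have e1 : (fun h => W c h + -176) = fun h => 2 ^ e * g h := by
    funext h
    rw [← sub_eq_add_neg, hg]
  rw [e1, pow_succ] at hv
  have hv' := VanishMod.div (by positivity) hv
  have hiff : ∀ h, ((2 : ℤ) ^ (e + 1) ∣ W c h - 176) ↔ 2 ∣ g h := by
    intro h
    rw [hg, pow_succ]
    exact mul_dvd_mul_iff_left (by positivity)
  simp only [hiff] at hne ⊢
  have := odd_count (by omega) hv' hne
  rwa [show 10 - (e + 1) = 9 - e by omega] at this

/-- The sum of `f` is nonnegative, which bounds the number of repeated columns. -/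
lemma f_nonneg (hc : ∀ i, c i ≠ 0) (hy : ∀ h, 0 ≤ y c h) (h : Fin 10 → ZMod 2) :
    0 ≤ y c h * (160 - 5 * y c h + 8 * E c h) := by
  by_cases h0 : h = 0
  · simp [h0, y_zero]
  · exact mul_nonneg (hy h) (corr_nonneg c hc hy h h0)

lemma N_le (hc : ∀ i, c i ≠ 0) (hy : ∀ h, 0 ≤ y c h) : N c ≤ 4 := by
  have h1 := sum_f c hc
  have h2 := Finset.sum_nonneg fun h (_ : h ∈ Finset.univ) => f_nonneg c hc hy h
  omega

/-- Counting bound for one divisibility level. -/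
lemma level (hc : ∀ i, c i ≠ 0) (hy : ∀ h, 0 ≤ y c h) (P : (Fin 10 → ZMod 2) → Prop)
    [DecidablePred P] (l : ℤ) (hl : 0 ≤ l) (n : ℕ) (hn0 : 0 < n)
    (hcard : n ≤ (Finset.univ.filter P).card)
    (hP : ∀ h, P h → 34560 - 8064 * N c + 2224 * l
      < n * (y c h * (160 - 5 * y c h + 8 * E c h) + l * y c h)) : False := by
  have hf := sum_f c hc
  have hs := sum_y c hc
  have hN := N_le c hc hy
  set X : ℤ := 34560 - 8064 * N c + 2224 * l with hX
  have hn : (0 : ℤ) ≤ n := by positivity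
  have hX0 : 0 ≤ X := by linarith
  have h1 : (Finset.univ.filter P).card • (X + 1)
      ≤ ∑ h ∈ Finset.univ.filter P,
        n * (y c h * (160 - 5 * y c h + 8 * E c h) + l * y c h) :=
    Finset.card_nsmul_le_sum _ _ _ fun h hh => hP h (Finset.mem_filter.1 hh).2
  have h2 : ∑ h ∈ Finset.univ.filter P, (n : ℤ) * (y c h * (160 - 5 * y c h + 8 * E c h) + l * y c h)
      ≤ ∑ h, (n : ℤ) * (y c h * (160 - 5 * y c h + 8 * E c h) + l * y c h) := by
    refine Finset.sum_le_sum_of_subset_of_nonneg (Finset.subset_univ _) fun h _ _ => ?_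
    exact mul_nonneg hn (add_nonneg (f_nonneg c hc hy h) (mul_nonneg hl (hy h)))
  have h3 : ∑ h, (y c h * (160 - 5 * y c h + 8 * E c h) + l * y c h) ≤ X := by
    have : ∑ h, l * y c h = l * 2224 := by rw [← Finset.mul_sum, hs]
    rw [Finset.sum_add_distrib, this]
    linarith
  rw [nsmul_eq_mul] at h1
  have h4 : (n : ℤ) * (X + 1) ≤ ((Finset.univ.filter P).card : ℤ) * (X + 1) :=
    mul_le_mul_of_nonneg_right (by exact_mod_cast hcard) (by linarith)
  have h5 := mul_le_mul_of_nonneg_left h3 hn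
  rw [Finset.mul_sum] at h5
  have h6 : (n : ℤ) ≤ 0 := by linarith
  have h7 : (0 : ℤ) < n := by exact_mod_cast hn0
  linarith

/-- The finite check for one divisibility level. -/
lemma level_check (hc : ∀ i, c i ≠ 0) (hy : ∀ h, 0 ≤ y c h) (e : ℕ) (l : ℤ) (n : ℕ)
    (he : (e = 0 ∧ l = 10 ∧ n = 512) ∨ (e = 1 ∧ l = 10 ∧ n = 256) ∨ (e = 2 ∧ l = 10 ∧ n = 128) ∨
      (e = 3 ∧ l = 10 ∧ n = 64) ∨ (e = 4 ∧ l = 0 ∧ n = 31))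
    (h : Fin 10 → ZMod 2) (h0 : h ≠ 0)
    (hd : (2 : ℤ) ^ e ∣ W c h - 176) (hnd : ¬ (2 : ℤ) ^ (e + 1) ∣ W c h - 176) :
    34560 - 8064 * N c + 2224 * l
      < n * (y c h * (160 - 5 * y c h + 8 * E c h) + l * y c h) := by
  have hyW : W c h - 176 = y c h := by simp [y, h0]
  rw [hyW] at hd hnd
  have hN := N_le c hc hy
  have hE := abs_le.1 (abs_E c h)
  have hT := corr_nonneg c hc hy h h0
  have hy0 := hy h
  have key : ∀ p ∈ [((0 : ℕ), (10 : ℤ), (512 : ℕ)), (1, 10, 256), (2, 10, 128), (3, 10, 64),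
      (4, 0, 31)], ∀ M ∈ Finset.Icc (0 : ℤ) 4, ∀ F ∈ Finset.Icc (-M) M, ∀ z ∈ Finset.Icc (0 : ℤ) 38,
      0 ≤ 160 - 5 * z + 8 * F → z % 2 ^ p.1 = 0 → z % 2 ^ (p.1 + 1) ≠ 0 →
      34560 - 8064 * M + 2224 * p.2.1 < p.2.2 * (z * (160 - 5 * z + 8 * F) + p.2.1 * z) := by
    decide +kernel
  refine key (e, l, n) ?_ (N c) ?_ (E c h) ?_ (y c h) ?_ hT (Int.emod_eq_zero_of_dvd hd) ?_
  · rcases he with ⟨rfl, rfl, rfl⟩ | ⟨rfl, rfl, rfl⟩ | ⟨rfl, rfl, rfl⟩ | ⟨rfl, rfl, rfl⟩ |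
      ⟨rfl, rfl, rfl⟩ <;> simp
  · rw [Finset.mem_Icc]; omega
  · rw [Finset.mem_Icc]; omega
  · rw [Finset.mem_Icc]; omega
  · exact fun h' => hnd (Int.dvd_of_emod_eq_zero h')

lemma W_zero : W c 0 = 0 := by simp [W, bit]

/-- One step up in divisibility. -/
lemma step (hc : ∀ i, c i ≠ 0) (hy : ∀ h, 0 ≤ y c h) (e : ℕ) (he : e < 4)
    (hd : ∀ h, (2 : ℤ) ^ e ∣ W c h - 176) (h : Fin 10 → ZMod 2) :
    (2 : ℤ) ^ (e + 1) ∣ W c h - 176 := by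
  by_contra hcon
  have hm := many c e (by omega) hd ⟨h, hcon⟩
  refine level c hc hy (fun h => ¬ (2 : ℤ) ^ (e + 1) ∣ W c h - 176) 10 (by norm_num) (2 ^ (9 - e))
    (by positivity) hm fun k hk => ?_
  have hk0 : k ≠ 0 := by
    rintro rfl
    apply hk
    rw [W_zero]
    interval_cases e <;> norm_num
  refine level_check c hc hy e 10 _ ?_ k hk0 (hd k) hk
  interval_cases e <;> simp

lemma card_filter_ne {α : Type*} [Fintype α] [DecidableEq α] (Q : α → Prop) [DecidablePred Q]
    (a : α) (n : ℕ) (h : n + 1 ≤ (Finset.univ.filter Q).card) :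
    n ≤ (Finset.univ.filter (fun x => Q x ∧ x ≠ a)).card := by
  have e : Finset.univ.filter (fun x => Q x ∧ x ≠ a) = (Finset.univ.filter Q).erase a := by
    ext x
    simp only [Finset.mem_filter, Finset.mem_erase, Finset.mem_univ, true_and]
    tauto
  rw [e]
  have := Finset.pred_card_le_card_erase (s := Finset.univ.filter Q) (a := a)
  omega

/-- There is no multiset of 356 nonzero columns all of whose nonzero codewords have weight at
least 176. -/
theorem core (hc : ∀ i, c i ≠ 0) (hW : ∀ h, h ≠ 0 → 176 ≤ W c h) : False := by
  have hy : ∀ h, 0 ≤ y c h := by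
    intro h
    by_cases h0 : h = 0
    · rw [h0, y_zero]
    · have := hW h h0
      simp only [y, h0, if_false]
      linarith
  have d0 : ∀ h, (2 : ℤ) ^ 0 ∣ W c h - 176 := fun h => by simp
  have d1 := step c hc hy 0 (by norm_num) d0
  have d2 := step c hc hy 1 (by norm_num) d1
  have d3 := step c hc hy 2 (by norm_num) d2
  have d4 := step c hc hy 3 (by norm_num) d3
  have hm := many c 4 (by norm_num) d4 ⟨0, by rw [W_zero]; norm_num⟩
  refine level c hc hy (fun h => ¬ (2 : ℤ) ^ (4 + 1) ∣ W c h - 176 ∧ h ≠ 0) 0 le_rfl 31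
    (by norm_num) ?_ fun k hk => level_check c hc hy 4 0 31 (by simp) k hk.2 (d4 k) hk.1
  exact card_filter_ne _ 0 31 hm

end core

end Code356

/-- There is no binary linear [356, 10, 176] code: every `ZMod 2`-linear subspace of
`Fin 356 → ZMod 2` of dimension 10 contains a nonzero codeword of Hamming weight
at most 175. -/
theorem no_binary_linear_code_356_10_176
    (C : Submodule (ZMod 2) (Fin 356 → ZMod 2))
    (hdim : Module.finrank (ZMod 2) C = 10) :
    ∃ c ∈ C, c ≠ 0 ∧ hammingNorm c ≤ 175 := by
  classical
  by_contra hcon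
  push Not at hcon
  let b := Module.finBasisOfFinrankEq (ZMod 2) C hdim
  let c0 : Fin 356 → Fin 10 → ZMod 2 := fun i j => (b j : Fin 356 → ZMod 2) i
  let p : Fin 10 → ZMod 2 := Pi.single 0 1
  let c : Fin 356 → Fin 10 → ZMod 2 := fun i => if c0 i = 0 then p else c0 i
  have hp : p ≠ 0 := fun h => by simpa [p] using congrFun h 0
  refine Code356.core c (fun i => ?_) fun h h0 => ?_
  · by_cases hi : c0 i = 0
    · simpa [c, hi] using hp
    · simp [c, hi]
  · let w : C := ∑ j, h j • b j
    have hw : w ≠ 0 := by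
      intro hw
      apply h0
      funext j
      exact (Fintype.linearIndependent_iff.1 b.linearIndependent) h hw j
    have hwi : ∀ i, (w : Fin 356 → ZMod 2) i = h ⬝ᵥ c0 i := by
      intro i
      simp [w, c0, dotProduct]
    have h1 := hcon w w.2 (by simpa using hw)
    have h2 : (hammingNorm (w : Fin 356 → ZMod 2) : ℤ) ≤ Code356.W c h := by
      rw [hammingNorm, Finset.card_filter, Code356.W]
      push_cast
      refine Finset.sum_le_sum fun i _ => ?_
      rw [hwi]
      by_cases hi : c0 i = 0
      · have : (0 : ℤ) ≤ Code356.bit (h ⬝ᵥ c i) := by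
          unfold Code356.bit
          split_ifs <;> simp
        simpa [hi] using this
      · simp [c, hi, Code356.bit]
    have h3 : (176 : ℤ) ≤ (hammingNorm (w : Fin 356 → ZMod 2) : ℤ) := by exact_mod_cast h1
    linarith
end

section
/- There is no binary linear [772, 11, 384] code. Equivalently: every F₂-linear subspace C of F₂^772 of dimension 11 contains a nonzero codeword of Hamming weight at most 383. -/
/-- The nontrivial additive character of `ZMod 2`. -/
def sgn2 (a : ZMod 2) : ℤ := if a = 0 then 1 else -1

theorem sgn2_add (a b : ZMod 2) : sgn2 (a + b) = sgn2 a * sgn2 b := by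
  revert a b; decide

/-- The message space. -/
abbrev V11 := Fin 11 → ZMod 2

/-- The characters of the message space. -/
def chi11 (v x : V11) : ℤ := sgn2 (v ⬝ᵥ x)

theorem chi11_add_right (v x y : V11) : chi11 v (x + y) = chi11 v x * chi11 v y := by
  simp [chi11, dotProduct_add, sgn2_add]

theorem chi11_add_left (u v x : V11) : chi11 (u + v) x = chi11 u x * chi11 v x := by
  simp [chi11, add_dotProduct, sgn2_add]

theorem chi11_comm (v x : V11) : chi11 v x = chi11 x v := by
  simp [chi11, dotProduct_comm]

theorem chi11_zero (x : V11) : chi11 0 x = 1 := by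
  simp [chi11, sgn2]

theorem sum_chi11 (v : V11) : ∑ x, chi11 v x = if v = 0 then 2048 else 0 := by
  split_ifs with h
  · subst h
    simp [chi11_zero, Fintype.card_pi, ZMod.card]
  · obtain ⟨j, hj⟩ : ∃ j, v j ≠ 0 := by
      by_contra! hc
      exact h (funext hc)
    have hneg : chi11 v (Pi.single j 1) = -1 := by
      simp [chi11, sgn2, hj]
    generalize (Pi.single j 1 : V11) = e at hneg
    have key : ∑ x, chi11 v (x + e) = ∑ x, chi11 v x := by
      refine Fintype.sum_equiv (Equiv.addRight e) _ _ fun x => ?_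
      rw [Equiv.coe_addRight]
    simp only [chi11_add_right, hneg] at key
    rw [← Finset.sum_mul] at key
    linarith

theorem sum_cube_nonneg (f : V11 → ℤ) (hf : ∀ x, 0 ≤ f x) :
    0 ≤ ∑ v, (∑ x, f x * chi11 v x) ^ 3 := by
  have h : ∀ v, (∑ x, f x * chi11 v x) ^ 3 =
      ∑ x, ∑ y, ∑ z, f x * f y * f z * chi11 (x + y + z) v := by
    intro v
    rw [pow_succ, pow_two, Finset.sum_mul_sum, Finset.sum_mul]
    refine Finset.sum_congr rfl fun x _ => ?_
    rw [Finset.sum_mul]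
    refine Finset.sum_congr rfl fun y _ => ?_
    rw [Finset.mul_sum]
    refine Finset.sum_congr rfl fun z _ => ?_
    rw [chi11_add_left, chi11_add_left, chi11_comm v x, chi11_comm v y, chi11_comm v z]
    ring
  simp only [h]
  rw [Finset.sum_comm]
  refine Finset.sum_nonneg fun x _ => ?_
  rw [Finset.sum_comm]
  refine Finset.sum_nonneg fun y _ => ?_
  rw [Finset.sum_comm]
  refine Finset.sum_nonneg fun z _ => ?_
  rw [← Finset.mul_sum, sum_chi11]
  have := mul_nonneg (mul_nonneg (hf x) (hf y)) (hf z)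
  split_ifs <;> linarith

theorem add_eq_zero_V11 (u v : V11) : u + v = 0 ↔ u = v := by
  have hd : ∀ a b : ZMod 2, a + b = 0 ↔ a = b := by decide
  simp only [funext_iff, Pi.add_apply, Pi.zero_apply, hd]

theorem cube_bound_zero (m : ℤ) (hm : 0 ≤ m) : (35 - 8 * m) ^ 3 ≤ 42875 - 152 * m := by
  nlinarith [mul_nonneg hm (sq_nonneg (16 * m - 105)), mul_nonneg hm hm]

theorem cube_bound (m : ℤ) (hm : 0 ≤ m) : (3 - 8 * m) ^ 3 ≤ 27 - 152 * m := by
  have h1 : 0 ≤ m * (m - 1) := by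
    rcases hm.eq_or_lt with h | h
    · simp [← h]
    · exact mul_nonneg hm (by linarith)
  nlinarith [mul_nonneg h1 hm]

/-- The core statement, for a system of 772 coordinate functionals on the message space. -/
theorem core_bound (u : Fin 772 → V11)
    (hu : ∀ x : V11, x ≠ 0 → (∑ i, chi11 (u i) x) ≤ 4) : False := by
  classical
  -- twice the excess weight
  let f : V11 → ℤ := fun x => 4 - ∑ i, chi11 (u i) x + if x = 0 then 768 else 0
  have hf : ∀ x, 0 ≤ f x := by
    intro x
    by_cases hx : x = 0
    · subst hx
      simp [f, chi11_comm _ (0 : V11), chi11_zero]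
    · have := hu x hx
      simp only [f, hx, if_false]
      linarith
  let m : V11 → ℤ := fun v => ∑ i, if u i = v then 1 else 0
  have hm : ∀ v, 0 ≤ m v := fun v => Finset.sum_nonneg fun i _ => by split_ifs <;> simp
  have hmsum : ∑ v, m v = 772 := by
    simp only [m]
    rw [Finset.sum_comm]
    simp
  have hF : ∀ v, ∑ x, f x * chi11 v x =
      256 * ((if v = 0 then 32 else 0) + 3 - 8 * m v) := by
    intro v
    have e1 : ∀ x, f x * chi11 v x = 4 * chi11 v x - ∑ i, chi11 (u i + v) x
        + (if x = 0 then 768 else 0) := by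
      intro x
      simp only [f, chi11_add_left, ← Finset.sum_mul]
      by_cases hx : x = 0
      · subst hx
        have : chi11 v 0 = 1 := by rw [chi11_comm, chi11_zero]
        simp [this]
      · simp only [hx, if_false]
        ring
    simp only [e1, Finset.sum_add_distrib, Finset.sum_sub_distrib, ← Finset.mul_sum, sum_chi11]
    rw [Finset.sum_comm]
    simp only [sum_chi11, add_eq_zero_V11]
    have e2 : ∑ i, (if u i = v then (2048 : ℤ) else 0) = 2048 * m v := by
      simp only [m, Finset.mul_sum]
      exact Finset.sum_congr rfl fun i _ => by split_ifs <;> simp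
    rw [e2, Finset.sum_ite_eq' Finset.univ (0 : V11) (fun _ => (768 : ℤ))]
    simp only [Finset.mem_univ, if_true]
    split_ifs <;> ring
  have hpos := sum_cube_nonneg f hf
  have hle : ∑ v, (∑ x, f x * chi11 v x) ^ 3 ≤
      ∑ v : V11, 256 ^ 3 * ((27 - 152 * m v) + if v = 0 then 42848 else 0) := by
    refine Finset.sum_le_sum fun v _ => ?_
    rw [hF v, mul_pow]
    refine mul_le_mul_of_nonneg_left ?_ (by norm_num)
    by_cases hv : v = 0
    · simp only [hv, if_true]
      have := cube_bound_zero (m 0) (hm 0)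
      have e : (32 + 3 - 8 * m 0) = 35 - 8 * m 0 := by ring
      rw [e]
      linarith
    · simp only [hv, if_false]
      have := cube_bound (m v) (hm v)
      have e : (0 + 3 - 8 * m v) = 3 - 8 * m v := by ring
      rw [e]
      linarith
  rw [← Finset.mul_sum, Finset.sum_add_distrib, Finset.sum_sub_distrib, ← Finset.mul_sum, hmsum,
    Finset.sum_ite_eq' Finset.univ (0 : V11) (fun _ => (42848 : ℤ))] at hle
  have hc : ∑ _v : V11, (27 : ℤ) = 27 * 2048 := by
    simp [Fintype.card_pi, ZMod.card]
  rw [hc] at hle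
  simp only [Finset.mem_univ, if_true] at hle
  norm_num at hle
  linarith

theorem sum_sgn2 (c : Fin 772 → ZMod 2) :
    ∑ i, sgn2 (c i) = 772 - 2 * (hammingNorm c : ℤ) := by
  have h : ∀ i, sgn2 (c i) = 1 - 2 * (if c i ≠ 0 then 1 else 0) := by
    intro i
    by_cases hi : c i = 0 <;> simp [sgn2, hi]
  rw [Finset.sum_congr rfl fun i _ => h i, Finset.sum_sub_distrib, ← Finset.mul_sum,
    Finset.sum_boole, Finset.sum_const, Finset.card_univ, Fintype.card_fin, nsmul_eq_mul, mul_one]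
  rfl

/-- There is no binary linear [772, 11, 384] code: every `ZMod 2`-linear subspace of
`Fin 772 → ZMod 2` of dimension 11 contains a nonzero codeword of Hamming weight
at most 383. -/
theorem no_binary_linear_code_772_11_384
    (C : Submodule (ZMod 2) (Fin 772 → ZMod 2))
    (hdim : Module.finrank (ZMod 2) C = 11) :
    ∃ c ∈ C, c ≠ 0 ∧ hammingNorm c ≤ 383 := by
  by_contra! hcon
  let b := Module.finBasisOfFinrankEq (ZMod 2) C hdim
  let u : Fin 772 → V11 := fun i j => (b j : Fin 772 → ZMod 2) i
  refine core_bound u fun x hx => ?_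
  let c : C := b.equivFun.symm x
  have hc0 : (c : Fin 772 → ZMod 2) ≠ 0 := by
    intro h
    have h1 : c = 0 := Subtype.ext h
    exact hx ((LinearEquiv.map_eq_zero_iff b.equivFun.symm).1 h1)
  have hw := hcon c c.2 hc0
  have hci : ∀ i, u i ⬝ᵥ x = (c : Fin 772 → ZMod 2) i := by
    intro i
    simp only [c, Module.Basis.equivFun_symm_apply, u, dotProduct]
    simp [mul_comm]
  have hs := sum_sgn2 (c : Fin 772 → ZMod 2)
  simp only [chi11, hci]
  rw [hs]
  omega
end

section
/- Better-than-linear property of the Gray image of the extended dualized Kerdock code: let C be any ℤ₄-submodule of ℤ₄^{994} with exactly 4^6 elements whose minimum Lee weight over nonzero codewords is 992. Then the Gray image ψ(C) ⊆ F₂^{1988} has exactly 2^{12} = 4096 elements and the minimum Hamming distance between distinct elements of ψ(C) is 992, whereas every F₂-linear subspace of F₂^{1988} of dimension 12 contains a nonzero codeword of Hamming weight at most 991; in particular, the minimum distance of ψ(C) strictly exceeds the minimum distance of every binary linear [1988, 12] code. -/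
/-- The Lee weight on `ZMod 4`: `w(0) = 0`, `w(1) = 1`, `w(2) = 2`, `w(3) = 1`. -/
def leeWt (a : ZMod 4) : ℕ := min a.val (4 - a.val)

/-- The Lee weight of a vector in `ZMod 4`ⁿ. -/
def leeWeight {n : ℕ} (x : Fin n → ZMod 4) : ℕ := ∑ i, leeWt (x i)

/-- The Gray map on a single symbol: `0 ↦ (0,0)`, `1 ↦ (1,0)`, `2 ↦ (1,1)`, `3 ↦ (0,1)`. -/
def grayBit (a : ZMod 4) : Fin 2 → ZMod 2 :=
  ![if a = 1 ∨ a = 2 then 1 else 0, if a = 2 ∨ a = 3 then 1 else 0]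

/-- The componentwise Gray map `ψ : ZMod 4ⁿ → ZMod 2^{2n}`. -/
def grayMap {n : ℕ} (x : Fin n → ZMod 4) : Fin n × Fin 2 → ZMod 2 :=
  fun p => grayBit (x p.1) p.2



namespace GrayCore
open Finset

abbrev V := Fin 12 → ZMod 2

def chi (c x : V) : ℤ := if c ⬝ᵥ x = 0 then 1 else -1

lemma zmod2_cases (a : ZMod 2) : a = 0 ∨ a = 1 := by
  revert a; decide

lemma vadd_self (x : V) : x + x = 0 := by
  funext i; exact CharTwo.add_self_eq_zero (x i)

lemma vadd_eq_zero {x y : V} : x + y = 0 ↔ x = y := by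
  constructor
  · intro h
    calc x = x + (y + y) := by rw [vadd_self, add_zero]
      _ = (x + y) + y := by rw [add_assoc]
      _ = y := by rw [h, zero_add]
  · rintro rfl; exact vadd_self x

lemma chi_comm (c x : V) : chi c x = chi x c := by
  unfold chi; rw [dotProduct_comm]

lemma chi_add_right (c x y : V) : chi c (x + y) = chi c x * chi c y := by
  unfold chi; rw [dotProduct_add]
  rcases zmod2_cases (c ⬝ᵥ x) with h | h <;> rcases zmod2_cases (c ⬝ᵥ y) with h' | h' <;>
    rw [h, h'] <;> decide

lemma chi_add_left (c d x : V) : chi (c + d) x = chi c x * chi d x := by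
  rw [chi_comm, chi_add_right, chi_comm x c, chi_comm x d]

lemma chi_zero_right (c : V) : chi c 0 = 1 := by simp [chi]
lemma chi_zero_left (c : V) : chi 0 c = 1 := by simp [chi]

lemma chi_le (c x : V) : chi c x ≤ 1 := by unfold chi; split_ifs <;> norm_num
lemma chi_ge (c x : V) : -1 ≤ chi c x := by unfold chi; split_ifs <;> norm_num

lemma chi_eq (c x : V) : chi c x = 1 ∨ chi c x = -1 := by unfold chi; split_ifs <;> simp

lemma card_V : Fintype.card V = 4096 := by simp [V]

/-- sum of a character over a subspace -/
lemma sum_chi_sub (Y : Submodule (ZMod 2) V) [DecidablePred (· ∈ Y)] (x : V)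
    (h : ∃ d ∈ Y, chi d x = -1) : ∑ c with c ∈ Y, chi c x = 0 := by
  obtain ⟨d, hd, hx⟩ := h
  have h1 : ∑ c with c ∈ Y, chi c x = ∑ c with c ∈ Y, chi (c + d) x := by
    symm
    apply Finset.sum_bij (fun c _ => c + d)
    · intro a ha; simp only [mem_filter, mem_univ, true_and] at ha ⊢; exact Y.add_mem ha hd
    · intro a _ b _ hab; exact add_right_cancel hab
    · intro b hb
      simp only [mem_filter, mem_univ, true_and] at hb
      refine ⟨b + d, ?_, ?_⟩
      · simp only [mem_filter, mem_univ, true_and]; exact Y.add_mem hb hd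
      · rw [add_assoc, vadd_self, add_zero]
    · intros; rfl
  simp only [chi_add_left, hx] at h1
  rw [← Finset.sum_mul] at h1
  linarith

lemma exists_chi {x : V} (hx : x ≠ 0) : ∃ d : V, chi d x = -1 := by
  obtain ⟨i, hi⟩ := Function.ne_iff.mp hx
  refine ⟨Pi.single i 1, ?_⟩
  have : (Pi.single i 1 : V) ⬝ᵥ x ≠ 0 := by simpa using hi
  simp only [chi, if_neg this]

lemma sum_chi (x : V) : ∑ c, chi c x = if x = 0 then 4096 else 0 := by
  split_ifs with h
  · subst h; simp [chi_zero_right]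
  · classical
    obtain ⟨d, hd⟩ := exists_chi h
    have := sum_chi_sub ⊤ x ⟨d, trivial, hd⟩
    simpa using this

def hat (f : V → ℤ) (c : V) : ℤ := ∑ x, f x * chi c x

lemma hat_zero (f : V → ℤ) : hat f 0 = ∑ x, f x := by simp [hat, chi_zero_left]

lemma conv (f g : V → ℤ) (a : V) :
    ∑ b, hat f b * hat g (a + b) = 4096 * hat (fun x => f x * g x) a := by
  have h1 : ∀ b, hat f b * hat g (a + b) =
      ∑ x, ∑ y, (f x * g y * chi a y) * chi b (x + y) := by
    intro b
    unfold hat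
    rw [Finset.sum_mul_sum]
    refine Finset.sum_congr rfl fun x _ => Finset.sum_congr rfl fun y _ => ?_
    rw [chi_add_left, chi_add_right]; ring
  simp_rw [h1]
  rw [Finset.sum_comm]
  unfold hat
  rw [Finset.mul_sum]
  refine Finset.sum_congr rfl fun x _ => ?_
  rw [Finset.sum_comm]
  simp_rw [← Finset.mul_sum, sum_chi, vadd_eq_zero]
  simp
  ring

lemma conv0 (f g : V → ℤ) : ∑ b, hat f b * hat g b = 4096 * ∑ x, f x * g x := by
  have := conv f g 0
  simpa [hat_zero] using this

lemma sum_hat (f : V → ℤ) : ∑ c, hat f c = 4096 * f 0 := by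
  unfold hat
  rw [Finset.sum_comm]
  simp_rw [← Finset.mul_sum, sum_chi]
  simp [mul_comm]

lemma inv (f : V → ℤ) (x : V) : ∑ c, hat f c * chi c x = 4096 * f x := by
  unfold hat
  simp_rw [Finset.sum_mul]
  rw [Finset.sum_comm]
  have : ∀ y c, f y * chi c y * chi c x = f y * chi c (y + x) := by
    intros; rw [chi_add_right]; ring
  simp_rw [this, ← Finset.mul_sum, sum_chi, vadd_eq_zero]
  simp [mul_comm]

lemma triple (f : V → ℤ) (a : V) :
    ∑ b, ∑ c, hat f b * (hat f c * hat f ((a + b) + c)) =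
      4096 ^ 2 * hat (fun x => f x ^ 3) a := by
  simp_rw [← Finset.mul_sum, conv]
  have : ∀ b, hat f b * (4096 * hat (fun x => f x * f x) (a + b)) =
      4096 * (hat f b * hat (fun x => f x * f x) (a + b)) := by intros; ring
  simp_rw [this, ← Finset.mul_sum, conv]
  rw [← mul_assoc]
  congr 2
  funext x; ring

lemma triple_lower (v : V → ℤ) (hv : ∀ c, 0 ≤ v c) (a : V) :
    3 * v a * ∑ c, v c ^ 2 - 2 * v a ^ 3 ≤
      ∑ b, ∑ c, v b * (v c * v ((a + b) + c)) := by
  have key : ∀ b c, (if b = a then v a * v c ^ 2 else 0) + (if c = a then v a * v b ^ 2 else 0)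
      + (if b = c then v a * v b ^ 2 else 0)
      - (if b = a then (if c = a then 2 * v a ^ 3 else 0) else 0)
      ≤ v b * (v c * v ((a + b) + c)) := by
    intro b c
    have h0 : 0 ≤ v b * (v c * v ((a + b) + c)) :=
      mul_nonneg (hv _) (mul_nonneg (hv _) (hv _))
    by_cases h1 : b = a
    · subst h1
      rw [vadd_self, zero_add]
      by_cases h2 : c = b
      · subst h2; simp; nlinarith
      · have h3 : ¬ b = c := fun h => h2 h.symm
        simp [h2, h3]; nlinarith
    · by_cases h2 : c = a
      · subst h2
        have : (c + b) + c = b := by rw [add_comm c b, add_assoc, vadd_self, add_zero]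
        simp [h1, this]; nlinarith
      · by_cases h3 : b = c
        · subst h3
          have : (a + b) + b = a := by rw [add_assoc, vadd_self, add_zero]
          simp [h1, this]; nlinarith
        · simp only [h1, h2, h3, if_false]; linarith
  have := Finset.sum_le_sum (fun b (_ : b ∈ (univ : Finset V)) =>
    Finset.sum_le_sum (fun c (_ : c ∈ (univ : Finset V)) => key b c))
  refine le_trans (le_of_eq ?_) this
  simp only [Finset.sum_add_distrib, Finset.sum_sub_distrib]
  simp only [Finset.sum_ite_irrel, Finset.sum_const_zero, Finset.sum_ite_eq', Finset.sum_ite_eq,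
    Finset.mem_univ, if_true, ← Finset.mul_sum]
  ring


/-- excess functions -/
def pf (K : V → ℤ) (x : V) : ℤ := if x = 0 then 0 else K x ^ 2 - 1
def Qf (K : V → ℤ) (x : V) : ℤ := if x = 0 then 0 else K x - K x ^ 3

lemma odd_cases {k : ℤ} (ho : Odd k) (hk : k ≤ 1) : k = 1 ∨ k = -1 ∨ k ≤ -3 := by
  obtain ⟨t, rfl⟩ := ho; omega

lemma odd_cases' {k : ℤ} (ho : Odd k) (hk : k ≤ 1) :
    k = 1 ∨ k = -1 ∨ k = -3 ∨ k = -5 ∨ k = -7 ∨ k ≤ -9 := by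
  obtain ⟨t, rfl⟩ := ho; omega

lemma hat_le_sum {f : V → ℤ} (hf : ∀ x, 0 ≤ f x) (a : V) : hat f a ≤ ∑ x, f x :=
  Finset.sum_le_sum fun x _ => by nlinarith [hf x, chi_le a x]

lemma hat_ge_sum {f : V → ℤ} (hf : ∀ x, 0 ≤ f x) (a : V) : - ∑ x, f x ≤ hat f a := by
  rw [← Finset.sum_neg_distrib]
  exact Finset.sum_le_sum fun x _ => by nlinarith [hf x, chi_ge a x]

lemma pf_nonneg (K : V → ℤ) (hodd : ∀ x, Odd (K x)) (hle : ∀ x, x ≠ 0 → K x ≤ 1)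
    (x : V) : 0 ≤ pf K x := by
  unfold pf; split_ifs with h
  · exact le_rfl
  · rcases odd_cases (hodd x) (hle x h) with h | h | h
    · rw [h]; norm_num
    · rw [h]; norm_num
    · nlinarith

lemma Qf_ge (K : V → ℤ) (hodd : ∀ x, Odd (K x)) (hle : ∀ x, x ≠ 0 → K x ≤ 1)
    (x : V) : 3 * pf K x ≤ Qf K x := by
  unfold pf Qf; split_ifs with h
  · norm_num
  · rcases odd_cases (hodd x) (hle x h) with h | h | h
    · rw [h]; norm_num
    · rw [h]; norm_num
    · nlinarith [mul_nonneg (show 0 ≤ -3 - K x by linarith) (show 0 ≤ K x ^ 2 - 1 by nlinarith)]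

lemma hat_sq (K : V → ℤ) (h0 : K 0 = 9)
    (a : V) (ha : a ≠ 0) : hat (fun x => K x * K x) a = 80 + hat (pf K) a := by
  have h1 : ∀ x, K x * K x * chi a x =
      chi a x + (if x = 0 then 80 else 0) + pf K x * chi a x := by
    intro x; unfold pf; split_ifs with h
    · subst h; rw [h0, chi_zero_right]; norm_num
    · ring
  have h2 : ∑ x, chi a x = 0 := by
    simp_rw [chi_comm a]; rw [sum_chi, if_neg ha]
  unfold hat
  simp_rw [h1, Finset.sum_add_distrib, h2]
  simp

lemma sum_sq (K : V → ℤ) (h0 : K 0 = 9)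
    : ∑ x, K x * K x = 4176 + ∑ x, pf K x := by
  have h1 : ∀ x, K x * K x = 1 + (if x = 0 then 80 else 0) + pf K x := by
    intro x; unfold pf; split_ifs with h
    · subst h; rw [h0]; norm_num
    · ring
  simp_rw [h1, Finset.sum_add_distrib]
  simp

lemma hat_cube (K : V → ℤ) (h0 : K 0 = 9)
    (a : V) : hat (fun x => K x ^ 3) a = hat K a + 720 - hat (Qf K) a := by
  have h1 : ∀ x, K x ^ 3 * chi a x =
      K x * chi a x + (if x = 0 then 720 else 0) - Qf K x * chi a x := by
    intro x; unfold Qf; split_ifs with h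
    · subst h; rw [h0, chi_zero_right]; norm_num
    · ring
  unfold hat
  simp_rw [h1, Finset.sum_sub_distrib, Finset.sum_add_distrib]
  simp

lemma sum_v_sq (K : V → ℤ) (h0 : K 0 = 9)
    : ∑ c, hat K c ^ 2 = 4096 * (4176 + ∑ x, pf K x) := by
  simp_rw [pow_two]; rw [conv0, sum_sq K h0]

lemma main_ineq (K : V → ℤ) (h0 : K 0 = 9) (hv : ∀ c, 0 ≤ hat K c)
    (a : V) :
    3 * hat K a * (4096 * (4176 + ∑ x, pf K x)) - 2 * hat K a ^ 3 ≤
      4096 ^ 2 * (hat K a + 720 - hat (Qf K) a) := by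
  have := triple_lower (hat K) hv a
  rwa [triple, sum_v_sq K h0, hat_cube K h0] at this

lemma step1 (K : V → ℤ) (h0 : K 0 = 9) (hsum : ∑ x, K x = 128) (hv : ∀ c, 0 ≤ hat K c)
    : 4096 * ∑ x, Qf K x + 384 * ∑ x, pf K x ≤ 1870848 := by
  have := main_ineq K h0 hv 0
  rw [hat_zero, hat_zero, hsum] at this
  linarith

lemma step2 (K : V → ℤ) (hodd : ∀ x, Odd (K x)) (h0 : K 0 = 9) (hle : ∀ x, x ≠ 0 → K x ≤ 1) (hsum : ∑ x, K x = 128) (hv : ∀ c, 0 ≤ hat K c)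
    (a : V) (ha : a ≠ 0) : hat K a ≤ 1280 + 16 * ∑ x, pf K x := by
  have h1 := conv K K a
  rw [hat_sq K h0 a ha] at h1
  have h2 : hat K 0 * hat K (a + 0) + hat K a * hat K (a + a) ≤
      ∑ b, hat K b * hat K (a + b) := by
    rw [← Finset.sum_pair (f := fun b => hat K b * hat K (a + b)) (Ne.symm ha)]
    exact Finset.sum_le_sum_of_subset_of_nonneg (Finset.subset_univ _)
      fun b _ _ => mul_nonneg (hv _) (hv _)
  rw [vadd_self, add_zero, hat_zero, hsum, h1] at h2
  have h3 := hat_le_sum (pf_nonneg K hodd hle) a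
  linarith

lemma p_le (K : V → ℤ) (hodd : ∀ x, Odd (K x)) (h0 : K 0 = 9) (hle : ∀ x, x ≠ 0 → K x ≤ 1) (hsum : ∑ x, K x = 128) (hv : ∀ c, 0 ≤ hat K c)
    : ∑ x, pf K x ≤ 147 ∧ ∑ x, Qf K x ≤ 456 ∧ 0 ≤ ∑ x, pf K x := by
  have h1 := step1 K h0 hsum hv
  have h2 : 3 * ∑ x, pf K x ≤ ∑ x, Qf K x := by
    rw [Finset.mul_sum]; exact Finset.sum_le_sum fun x _ => Qf_ge K hodd hle x
  have h3 : 0 ≤ ∑ x, pf K x := Finset.sum_nonneg fun x _ => pf_nonneg K hodd hle x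
  omega

lemma step3 (K : V → ℤ) (hodd : ∀ x, Odd (K x)) (h0 : K 0 = 9) (hle : ∀ x, x ≠ 0 → K x ≤ 1) (hsum : ∑ x, K x = 128) (hv : ∀ c, 0 ≤ hat K c)
    (a : V) : hat K a ≤ 640 := by
  by_cases ha : a = 0
  · rw [ha, hat_zero, hsum]; norm_num
  obtain ⟨h1, h2, h3⟩ := p_le K hodd h0 hle hsum hv
  have h4 := step2 K hodd h0 hle hsum hv a ha
  have h5 := main_ineq K h0 hv a
  have hQ : ∀ x, 0 ≤ Qf K x := fun x => by
    have := Qf_ge K hodd hle x; have := pf_nonneg K hodd hle x; linarith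
  have h6 := hat_ge_sum hQ a
  set v := hat K a
  set p := ∑ x, pf K x
  by_contra hc
  push Not at hc
  have h7 : v ≤ 3632 := by linarith
  have h8 : 0 ≤ (v - 640) * (3632 - v) := mul_nonneg (by linarith) (by linarith)
  have h9 : 0 ≤ (v - 640) * (3632 - v) * (v + 4272) := mul_nonneg h8 (by linarith)
  have h10 : 0 ≤ v * p := mul_nonneg (by linarith) h3
  nlinarith

lemma step4 (K : V → ℤ) (hodd : ∀ x, Odd (K x)) (h0 : K 0 = 9) (hle : ∀ x, x ≠ 0 → K x ≤ 1) (hsum : ∑ x, K x = 128) (hv : ∀ c, 0 ≤ hat K c)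
    : (4176 + ∑ x, pf K x) * (8232 + 3 * ∑ x, pf K x) ≤
    4096 * (6480 - ∑ x, K x * Qf K x) := by
  have h1 : ∀ a, hat K a * hat K a * (3 * (4096 * (4176 + ∑ x, pf K x)) - 819200) ≤
      4096 ^ 2 * (hat K a * hat K a + 720 * hat K a - hat K a * hat (Qf K) a) := by
    intro a
    have h2 := main_ineq K h0 hv a
    have h3 := step3 K hodd h0 hle hsum hv a
    have h4 := mul_le_mul_of_nonneg_left h2 (hv a)
    have h5 : 0 ≤ (hat K a * hat K a) * ((640 - hat K a) * (640 + hat K a)) :=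
      mul_nonneg (mul_nonneg (hv a) (hv a))
        (mul_nonneg (by linarith) (by linarith [hv a]))
    nlinarith
  have h2 := Finset.sum_le_sum (fun a (_ : a ∈ (univ : Finset V)) => h1 a)
  rw [← Finset.sum_mul, ← Finset.mul_sum, Finset.sum_sub_distrib, Finset.sum_add_distrib,
    ← Finset.mul_sum, conv0, conv0, sum_hat, h0, sum_sq K h0] at h2
  nlinarith

lemma exists_quad (K : V → ℤ) (hodd : ∀ x, Odd (K x)) (h0 : K 0 = 9) (hle : ∀ x, x ≠ 0 → K x ≤ 1) (hsum : ∑ x, K x = 128) (hv : ∀ c, 0 ≤ hat K c)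
    : ∃ p, p ≠ 0 ∧ K p = -7 := by
  by_contra hc
  push Not at hc
  obtain ⟨h1, h2, h3⟩ := p_le K hodd h0 hle hsum hv
  have hQ : ∀ x, 0 ≤ Qf K x := fun x => by
    have := Qf_ge K hodd hle x; have := pf_nonneg K hodd hle x; linarith
  have hK : ∀ x, x ≠ 0 → -5 ≤ K x := by
    intro x hx
    have hQx : Qf K x ≤ 456 := le_trans
      (Finset.single_le_sum (fun y _ => hQ y) (Finset.mem_univ x)) h2
    rw [Qf, if_neg hx] at hQx
    rcases odd_cases' (hodd x) (hle x hx) with h | h | h | h | h | h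
    · omega
    · omega
    · omega
    · omega
    · exact absurd h (hc x hx)
    · nlinarith [mul_nonneg (show 0 ≤ -9 - K x by linarith) (sq_nonneg (K x))]
  have hb : ∀ x, Qf K x ≤ 5 * pf K x ∧ - (K x * Qf K x) ≤ 5 * Qf K x := by
    intro x
    have hp := pf_nonneg K hodd hle x
    have hq := hQ x
    by_cases hx : x = 0
    · simp [Qf, pf, hx]
    · have := hK x hx
      constructor
      · simp only [Qf, pf, if_neg hx] at hp ⊢
        nlinarith [mul_nonneg (show 0 ≤ K x + 5 by linarith) hp]
      · nlinarith
  have h4 : ∑ x, Qf K x ≤ 5 * ∑ x, pf K x := by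
    rw [Finset.mul_sum]; exact Finset.sum_le_sum fun x _ => (hb x).1
  have h5 : - ∑ x, K x * Qf K x ≤ 5 * ∑ x, Qf K x := by
    rw [Finset.mul_sum, ← Finset.sum_neg_distrib]
    exact Finset.sum_le_sum fun x _ => (hb x).2
  have h6 := step1 K h0 hsum hv
  have h7 := step4 K hodd h0 hle hsum hv
  nlinarith


lemma no_quad (K : V → ℤ) (hodd : ∀ x, Odd (K x)) (h0 : K 0 = 9) (hle : ∀ x, x ≠ 0 → K x ≤ 1) (hsum : ∑ x, K x = 128) (hv : ∀ c, 0 ≤ hat K c)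
    (p : V) (hp0 : p ≠ 0) (hp : K p = -7) : False := by
  classical
  have hex : ∀ x, ∃ j, K x + K (x + p) = 2 * j := by
    intro x
    obtain ⟨s, hs⟩ := hodd x
    obtain ⟨t, ht⟩ := hodd (x + p)
    exact ⟨s + t + 1, by rw [hs, ht]; ring⟩
  choose J hJ using hex
  have hJ0 : J 0 = 1 := by
    have := hJ 0; rw [zero_add, h0, hp] at this; linarith
  -- transform of J
  have hhat : ∀ a, 2 * hat J a = hat K a * (1 + chi a p) := by
    intro a
    have h1 : ∑ x, K (x + p) * chi a x = hat K a * chi a p := by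
      unfold hat
      rw [Finset.sum_mul, ← Equiv.sum_comp (Equiv.addRight p) (fun x => K x * chi a x * chi a p)]
      refine Finset.sum_congr rfl fun x _ => ?_
      simp only [Equiv.coe_addRight]
      rw [chi_add_right]
      have : chi a p * chi a p = 1 := by rcases chi_eq a p with h | h <;> rw [h] <;> norm_num
      linear_combination (- K (x + p) * chi a x) * this
    have h2 : 2 * hat J a = ∑ x, (K x * chi a x + K (x + p) * chi a x) := by
      unfold hat; rw [Finset.mul_sum]
      refine Finset.sum_congr rfl fun x _ => ?_
      linear_combination (- chi a x) * hJ x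
    rw [h2, Finset.sum_add_distrib, h1]
    unfold hat; ring
  have hin : ∀ a, chi a p = 1 → hat J a = hat K a := by
    intro a h; have := hhat a; rw [h] at this; linarith
  have hout : ∀ a, chi a p = -1 → hat J a = 0 := by
    intro a h; have := hhat a; rw [h] at this; linarith
  have hnn : ∀ a, 0 ≤ hat J a := by
    intro a; rcases chi_eq a p with h | h
    · rw [hin a h]; exact hv a
    · rw [hout a h]
  have hh0 : hat J 0 = 128 := by rw [hin 0 (chi_zero_left p), hat_zero, hsum]
  -- J is 0 or 1
  have hJ1 : ∀ x, J x ≤ 1 := by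
    intro x
    have h1 := inv J x
    have h2 := inv J 0
    have h3 : ∑ c, hat J c * chi c x ≤ ∑ c, hat J c * chi c 0 :=
      Finset.sum_le_sum fun c _ => by
        rw [chi_zero_right]; nlinarith [hnn c, chi_le c x]
    rw [h1, h2, hJ0] at h3; linarith
  have hJn : ∀ x, 0 ≤ J x := by
    intro x
    have h1 := inv J x
    have h2 := inv J 0
    have h3 : hat J 0 * chi 0 x + hat J 0 * chi 0 0 ≤
        ∑ c, (hat J c * chi c x + hat J c * chi c 0) := by
      refine Finset.single_le_sum (f := fun c => hat J c * chi c x + hat J c * chi c 0)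
        (fun c _ => ?_) (Finset.mem_univ 0)
      simp only [chi_zero_right]; nlinarith [hnn c, chi_ge c x]
    rw [Finset.sum_add_distrib, h1, h2, hJ0, hh0, chi_zero_left, chi_zero_left] at h3
    linarith
  have hJsq : ∀ x, J x * J x = J x := by
    intro x
    have h1 := hJ1 x
    have h2 := hJn x
    have : J x = 0 ∨ J x = 1 := by omega
    rcases this with h | h <;> rw [h] <;> norm_num
  have hsJ : ∑ x, J x = 128 := by rw [← hat_zero]; exact hh0
  have hJle : ∀ a, hat J a ≤ 128 := fun a => by rw [← hsJ]; exact hat_le_sum hJn a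
  have hs1 : ∑ c, hat J c = 4096 := by rw [sum_hat, hJ0]; norm_num
  have hs2 : ∑ c, hat J c * hat J c = 4096 * 128 := by
    rw [conv0]; simp_rw [hJsq]; rw [hsJ]
  have hval : ∀ a, hat J a * (128 - hat J a) = 0 := by
    have h1 : ∑ a, hat J a * (128 - hat J a) = 0 := by
      simp_rw [mul_sub]
      rw [Finset.sum_sub_distrib, hs2, ← Finset.sum_mul, hs1]; norm_num
    have h2 := (Finset.sum_eq_zero_iff_of_nonneg (fun a _ =>
      mul_nonneg (hnn a) (by linarith [hJle a]))).mp h1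
    exact fun a => h2 a (Finset.mem_univ a)
  -- product K * J
  have hKJ : ∀ x, K x * J x = J x + (if x = 0 then 8 else 0) - (if x = p then 8 else 0) := by
    intro x
    by_cases hx : x = 0
    · subst hx; rw [if_pos rfl, if_neg (Ne.symm hp0), h0, hJ0]; norm_num
    by_cases hxp : x = p
    · subst hxp
      have : J x = 1 := by
        have := hJ x; rw [vadd_self, h0, hp] at this; linarith
      rw [if_neg hx, if_pos rfl, hp, this]; norm_num
    rw [if_neg hx, if_neg hxp]
    have h1 := hJ1 x
    have h2 := hJn x
    have h3 : J x = 0 ∨ J x = 1 := by omega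
    rcases h3 with h | h
    · rw [h]; norm_num
    · have h4 := hJ x
      have h5 := hle x hx
      have h6 := hle (x + p) (fun h => hxp (vadd_eq_zero.mp h))
      have : K x = 1 := by rw [h] at h4; linarith
      rw [h, this]; norm_num
  have hKJhat : ∀ a, chi a p = -1 → hat (fun x => J x * K x) a = 16 := by
    intro a ha
    have h1 : ∀ x, J x * K x * chi a x = J x * chi a x + (if x = 0 then 8 else 0)
        + (if x = p then 8 else 0) := by
      intro x
      rw [mul_comm (J x), hKJ x]
      by_cases hx : x = 0
      · subst hx; rw [if_pos rfl, if_neg (Ne.symm hp0), chi_zero_right]; ring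
      by_cases hxp : x = p
      · subst hxp; rw [if_neg hx, if_pos rfl, ha]; ring
      rw [if_neg hx, if_neg hxp]; ring
    have h2 := hout a ha
    unfold hat at h2 ⊢
    simp_rw [h1, Finset.sum_add_distrib, h2]
    simp
  have h512 : ∀ a, chi a p = -1 → hat K a ≤ 512 := by
    intro a ha
    have h1 := conv J K a
    rw [hKJhat a ha] at h1
    have h2 : hat J 0 * hat K (a + 0) ≤ ∑ b, hat J b * hat K (a + b) :=
      Finset.single_le_sum (f := fun b => hat J b * hat K (a + b))
        (fun b _ => mul_nonneg (hnn b) (hv _)) (Finset.mem_univ 0)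
    rw [h1, hh0, add_zero] at h2
    linarith
  -- outside part
  have hov : ∀ a, 0 ≤ (hat K a - hat J a) * (512 - (hat K a - hat J a)) := by
    intro a; rcases chi_eq a p with h | h
    · rw [hin a h]; norm_num
    · rw [hout a h, sub_zero]; exact mul_nonneg (hv a) (by linarith [h512 a h])
  have hJK : ∀ a, hat K a * hat J a = hat J a * hat J a := by
    intro a; rcases chi_eq a p with h | h
    · rw [hin a h]
    · rw [hout a h]; norm_num
  have hpf : 48 ≤ ∑ x, pf K x := by
    have h1 : pf K p = 48 := by rw [pf, if_neg hp0, hp]; norm_num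
    rw [← h1]
    exact Finset.single_le_sum (fun y _ => pf_nonneg K hodd hle y) (Finset.mem_univ p)
  have hz : ∀ a, (hat K a - hat J a) * (512 - (hat K a - hat J a)) = 0 := by
    have h1 : ∑ a, (hat K a - hat J a) * (512 - (hat K a - hat J a)) ≤ 0 := by
      have h2 : ∀ a, (hat K a - hat J a) * (512 - (hat K a - hat J a)) =
          512 * hat K a - 512 * hat J a - hat K a * hat K a + hat J a * hat J a := by
        intro a; linear_combination 2 * hJK a
      simp_rw [h2]
      rw [Finset.sum_add_distrib, Finset.sum_sub_distrib, Finset.sum_sub_distrib,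
        ← Finset.mul_sum, ← Finset.mul_sum, hs1, hs2, sum_hat, h0, conv0, sum_sq K h0]
      linarith
    have h3 := (Finset.sum_eq_zero_iff_of_nonneg (fun a _ => hov a)).mp
      (le_antisymm h1 (Finset.sum_nonneg fun a _ => hov a))
    exact fun a => h3 a (Finset.mem_univ a)
  -- the subspace W
  let W : Submodule (ZMod 2) V :=
    { carrier := {a | ∀ x, J x = 1 → a ⬝ᵥ x = 0}
      add_mem' := by
        intro a b ha hb x hx
        rw [add_dotProduct, ha x hx, hb x hx, add_zero]
      zero_mem' := by intro x _; exact zero_dotProduct x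
      smul_mem' := by
        intro c a ha x hx
        rw [smul_dotProduct, ha x hx, smul_zero] }
  have hWmem : ∀ a, a ∈ W ↔ ∀ x, J x = 1 → a ⬝ᵥ x = 0 := fun a => Iff.rfl
  have hW : ∀ a, a ∈ W ↔ hat J a = 128 := by
    intro a
    rw [hWmem]
    constructor
    · intro h
      rw [← hsJ]
      refine Finset.sum_congr rfl fun x _ => ?_
      have h1 := hJ1 x
      have h2 := hJn x
      have h3 : J x = 0 ∨ J x = 1 := by omega
      rcases h3 with h3 | h3
      · rw [h3]; norm_num
      · rw [chi, if_pos (h x h3), mul_one]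
    · intro h x hx
      by_contra hne
      have h4 : hat J a < ∑ x, J x := by
        refine Finset.sum_lt_sum (fun y _ => by nlinarith [hJn y, chi_le a y])
          ⟨x, Finset.mem_univ x, ?_⟩
        rw [hx, chi, if_neg hne]; norm_num
      rw [hsJ] at h4; linarith
  have hWcard : ((univ.filter (· ∈ W)).card : ℤ) = 32 := by
    have h1 : ∀ a, hat J a = if a ∈ W then 128 else 0 := by
      intro a
      split_ifs with h
      · exact (hW a).mp h
      · have h2 := hval a
        rcases mul_eq_zero.mp h2 with h3 | h3
        · exact h3
        · exact absurd ((hW a).mpr (by linarith)) h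
    have h2 : ∑ a, hat J a = (univ.filter (· ∈ W)).card * 128 := by
      simp_rw [h1]
      rw [← Finset.sum_filter, Finset.sum_const, nsmul_eq_mul]
    rw [hs1] at h2; linarith
  have hcardsub : ∀ Z : Submodule (ZMod 2) V,
      (univ.filter (· ∈ Z)).card = 2 ^ Module.finrank (ZMod 2) Z := by
    intro Z
    have h1 := Module.card_eq_pow_finrank (K := ZMod 2) (V := Z)
    rw [ZMod.card] at h1
    rw [← h1, Fintype.card_subtype]
  have hWdim : Module.finrank (ZMod 2) W = 5 := by
    have h1 := hcardsub W
    have h2 : (univ.filter (· ∈ W)).card = 2 ^ 5 := by exact_mod_cast hWcard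
    rw [h2] at h1
    exact (Nat.pow_right_injective (le_refl 2) h1).symm
  obtain ⟨Y, hY⟩ := Submodule.exists_isCompl W
  have hYdim : Module.finrank (ZMod 2) Y = 7 := by
    have h1 := Submodule.finrank_add_eq_of_isCompl hY
    rw [hWdim] at h1
    have h2 : Module.finrank (ZMod 2) V = 12 := by simp [V]
    omega
  have hYcard : (univ.filter (· ∈ Y)).card = 128 := by rw [hcardsub, hYdim]; norm_num
  -- dual of Y
  have hchar : ∀ x, ∑ c with c ∈ Y, chi c x = if (∀ c ∈ Y, chi c x = 1) then 128 else 0 := by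
    intro x
    split_ifs with h
    · rw [Finset.sum_congr rfl (fun c hc => h c (Finset.mem_filter.mp hc).2)]
      rw [Finset.sum_const, hYcard]; norm_num
    · push Not at h
      obtain ⟨d, hd, hdx⟩ := h
      exact sum_chi_sub Y x ⟨d, hd, (chi_eq d x).resolve_left hdx⟩
  set A : Finset V := univ.filter (fun x => ∀ c ∈ Y, chi c x = 1) with hA
  have hAcard : (A.card : ℤ) = 32 := by
    have h1 : ∑ x, ∑ c with c ∈ Y, chi c x = 4096 := by
      rw [Finset.sum_comm]
      have h2 : ∀ c : V, ∑ x, chi c x = if c = 0 then 4096 else 0 := by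
        intro c; simp_rw [chi_comm c]; exact sum_chi c
      simp_rw [h2]
      simp
    simp_rw [hchar] at h1
    rw [← Finset.sum_filter, Finset.sum_const, nsmul_eq_mul, ← hA] at h1
    linarith
  have hYsum : ∑ c with c ∈ Y, hat K c = 128 * ∑ x ∈ A, K x := by
    unfold hat
    rw [Finset.sum_comm]
    simp_rw [← Finset.mul_sum, hchar]
    rw [hA, Finset.sum_filter, Finset.mul_sum]
    refine Finset.sum_congr rfl fun x _ => ?_
    split_ifs <;> ring
  have hmod : ∀ c, c ∈ Y → ∃ t, hat K c = 512 * t + (if c = 0 then 128 else 0) := by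
    intro c hc
    by_cases h : c = 0
    · subst h; exact ⟨0, by rw [if_pos rfl, hat_zero, hsum]; norm_num⟩
    · rw [if_neg h]
      have hcW : c ∉ W := fun hw => h ((Submodule.disjoint_def.mp hY.disjoint) c hw hc)
      have hJc : hat J c = 0 := by
        rcases mul_eq_zero.mp (hval c) with h3 | h3
        · exact h3
        · exact absurd ((hW c).mpr (by linarith)) hcW
      have := hz c
      rw [hJc, sub_zero] at this
      rcases mul_eq_zero.mp this with h3 | h3
      · exact ⟨0, by rw [h3]; norm_num⟩
      · exact ⟨1, by linarith⟩
  have hmod2 : (∑ c with c ∈ Y, hat K c) ≡ 128 [ZMOD 512] := by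
    have h1 : ∀ c ∈ univ.filter (· ∈ Y), hat K c ≡ (if c = 0 then 128 else 0) [ZMOD 512] := by
      intro c hc
      obtain ⟨t, ht⟩ := hmod c (Finset.mem_filter.mp hc).2
      rw [ht]
      exact Int.ModEq.symm (Int.modEq_iff_dvd.mpr ⟨t, by ring⟩)
    have h2 := Int.ModEq.sum h1
    have h3 : ∑ c with c ∈ Y, (if c = 0 then (128 : ℤ) else 0) = 128 := by
      rw [Finset.sum_ite_eq']
      simp
    rwa [h3] at h2
  have hev : (∑ x ∈ A, K x) ≡ 0 [ZMOD 2] := by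
    have h1 : ∀ x ∈ A, K x ≡ 1 [ZMOD 2] := by
      intro x _
      obtain ⟨t, ht⟩ := hodd x
      rw [ht]; exact Int.ModEq.symm (Int.modEq_iff_dvd.mpr ⟨t, by ring⟩)
    have h2 := Int.ModEq.sum h1
    rw [Finset.sum_const, nsmul_eq_mul, hAcard] at h2
    exact h2.trans (by decide)
  rw [hYsum] at hmod2
  unfold Int.ModEq at hmod2 hev
  omega

theorem core_false (K : V → ℤ) (hodd : ∀ x, Odd (K x)) (h0 : K 0 = 9) (hle : ∀ x, x ≠ 0 → K x ≤ 1) (hsum : ∑ x, K x = 128) (hv : ∀ c, 0 ≤ hat K c)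
    : False := by
  obtain ⟨p, hp0, hp⟩ := exists_quad K hodd h0 hle hsum hv
  exact no_quad K hodd h0 hle hsum hv p hp0 hp

end GrayCore

namespace GrayCore
open Finset

theorem columns_false {ι : Type*} [Fintype ι] (hι : Fintype.card ι = 1988) (g : ι → V)
    (hg : ∀ i, g i ≠ 0)
    (hw : ∀ c : V, c ≠ 0 → 992 ≤ (univ.filter fun i => c ⬝ᵥ g i ≠ 0).card) : False := by
  classical
  let m : V → ℤ := fun x => ((univ.filter fun i => g i = x).card : ℤ)
  have hm : ∀ x, 0 ≤ m x := fun x => by positivity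
  let K : V → ℤ := fun x => if x = 0 then 9 else 1 - 2 * m x
  have hm0 : m 0 = 0 := by
    simp only [m, Nat.cast_eq_zero, Finset.card_eq_zero, Finset.filter_eq_empty_iff]
    intro i _; exact hg i
  have hK0 : K 0 = 9 := by simp [K]
  have hsumm : ∀ c, ∑ x, m x * chi c x = ∑ i, chi c (g i) := by
    intro c
    rw [← Finset.sum_fiberwise (s := univ) (g := g) (f := fun i => chi c (g i))]
    refine Finset.sum_congr rfl fun x _ => ?_
    rw [Finset.sum_congr rfl (g := fun _ => chi c x)
      (fun i hi => by rw [(Finset.mem_filter.mp hi).2])]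
    rw [Finset.sum_const, nsmul_eq_mul]
  have hhat : ∀ c, hat K c = (if c = 0 then 4096 else 0) + 8 - 2 * ∑ i, chi c (g i) := by
    intro c
    have h1 : ∀ x, K x * chi c x = chi c x + (if x = 0 then 8 else 0) - 2 * (m x * chi c x) := by
      intro x
      by_cases hx : x = 0
      · subst hx; rw [hK0, if_pos rfl, hm0, chi_zero_right]; norm_num
      · simp only [K, if_neg hx]; ring
    have h2 : ∑ x, chi c x = if c = 0 then 4096 else 0 := by
      simp_rw [chi_comm c]; exact sum_chi c
    unfold hat
    simp_rw [h1]
    rw [Finset.sum_sub_distrib, Finset.sum_add_distrib, ← Finset.mul_sum, hsumm, h2]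
    simp
  have hchi : ∀ c, ∑ i, chi c (g i) = 1988 - 2 * ((univ.filter fun i => c ⬝ᵥ g i ≠ 0).card : ℤ) := by
    intro c
    have h1 : ∀ i, chi c (g i) = 1 - 2 * (if c ⬝ᵥ g i ≠ 0 then 1 else 0) := by
      intro i; unfold chi; split_ifs <;> simp_all
    simp_rw [h1]
    rw [Finset.sum_sub_distrib, ← Finset.mul_sum, Finset.sum_boole, Finset.sum_const,
      Finset.card_univ, hι]
    norm_num
  have hz : hat K 0 = 128 := by
    rw [hhat, hchi]; simp
  refine core_false K ?_ hK0 ?_ ?_ ?_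
  · intro x
    by_cases hx : x = 0
    · subst hx; rw [hK0]; decide
    · simp only [K, if_neg hx]; exact ⟨- m x, by ring⟩
  · intro x hx
    simp only [K, if_neg hx]; linarith [hm x]
  · rw [← hat_zero]; exact hz
  · intro c
    by_cases hc : c = 0
    · rw [hc, hz]; norm_num
    · rw [hhat, hchi, if_neg hc]
      have : (992 : ℤ) ≤ ((univ.filter fun i => c ⬝ᵥ g i ≠ 0).card : ℤ) := by
        exact_mod_cast hw c hc
      linarith

theorem linear_bound_gen {ι : Type*} [Fintype ι] (hι : Fintype.card ι = 1988)
    (D : Submodule (ZMod 2) (ι → ZMod 2))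
    (hD : Module.finrank (ZMod 2) D = 12) : ∃ c ∈ D, c ≠ 0 ∧ hammingNorm c ≤ 991 := by
  classical
  by_contra hc
  push Not at hc
  let b := Module.finBasisOfFinrankEq (ZMod 2) D hD
  let g : ι → V := fun i j => (b j : ι → ZMod 2) i
  let e : V := Pi.single 0 1
  have he : e ≠ 0 := by
    intro h
    have := congrFun h 0
    simp [e] at this
  refine columns_false hι (fun i => if g i = 0 then e else g i) ?_ ?_
  · intro i
    split_ifs with h
    · exact he
    · exact h
  · intro c hc0
    let w : D := ∑ j, c j • b j
    have hwi : ∀ i, (w : ι → ZMod 2) i = c ⬝ᵥ g i := by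
      intro i
      simp [w, g, dotProduct, Finset.sum_apply]
    have hw0 : (w : ι → ZMod 2) ≠ 0 := by
      intro h
      have h1 : w = 0 := Subtype.ext h
      have h2 := Fintype.linearIndependent_iff.mp b.linearIndependent c h1
      exact hc0 (funext h2)
    have h1 := hc w w.2 hw0
    have h2 : hammingNorm (w : ι → ZMod 2) ≤
        (univ.filter fun i => c ⬝ᵥ (if g i = 0 then e else g i) ≠ 0).card := by
      unfold hammingNorm
      refine Finset.card_le_card ?_
      intro i hi
      simp only [Finset.mem_filter, Finset.mem_univ, true_and, hwi] at hi ⊢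
      by_cases h : g i = 0
      · rw [h, dotProduct_zero] at hi; exact absurd rfl hi
      · rw [if_neg h]; exact hi
    omega

theorem linear_bound (D : Submodule (ZMod 2) (Fin 994 × Fin 2 → ZMod 2))
    (hD : Module.finrank (ZMod 2) D = 12) : ∃ c ∈ D, c ≠ 0 ∧ hammingNorm c ≤ 991 :=
  linear_bound_gen (by simp) D hD

lemma gray_dist_symbol (a b : ZMod 4) :
    (if grayBit a 0 ≠ grayBit b 0 then 1 else 0) + (if grayBit a 1 ≠ grayBit b 1 then 1 else 0)
      = leeWt (a - b) := by
  revert a b; decide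

lemma gray_dist {n : ℕ} (x y : Fin n → ZMod 4) :
    hammingDist (grayMap x) (grayMap y) = leeWeight (x - y) := by
  unfold hammingDist leeWeight
  rw [Finset.card_filter, Fintype.sum_prod_type]
  refine Finset.sum_congr rfl fun i _ => ?_
  rw [Fin.sum_univ_two]
  exact gray_dist_symbol (x i) (y i)

lemma leeWt_eq_zero (a : ZMod 4) (h : leeWt a = 0) : a = 0 := by
  revert a; decide

lemma gray_inj {n : ℕ} : Function.Injective (grayMap (n := n)) := by
  intro x y h
  have h1 := gray_dist x y
  rw [h, hammingDist_self] at h1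
  have h2 := (Finset.sum_eq_zero_iff).mp h1.symm
  funext i
  exact sub_eq_zero.mp (leeWt_eq_zero _ (h2 i (Finset.mem_univ i)))

end GrayCore

/-- Better-than-linear property of the Gray image of the extended dualized Kerdock code
`K̂*₆`: for any `ZMod 4`-linear code `C ⊆ ZMod 4^994` with `4^6` codewords and minimum
Lee weight exactly `992`, the Gray image `ψ(C) ⊆ ZMod 2^1988` has `2^12 = 4096` elements
and minimum Hamming distance exactly `992`, whereas every binary linear code of length
`1988` and dimension `12` contains a nonzero codeword of Hamming weight at most `991`. -/
theorem gray_image_better_than_linear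
    (C : Submodule (ZMod 4) (Fin 994 → ZMod 4))
    (hcard : Nat.card C = 4 ^ 6)
    (hmin : IsLeast {w : ℕ | ∃ c ∈ C, c ≠ 0 ∧ leeWeight c = w} 992) :
    Nat.card (grayMap '' (C : Set (Fin 994 → ZMod 4))) = 4096 ∧
    IsLeast {m : ℕ | ∃ u ∈ grayMap '' (C : Set (Fin 994 → ZMod 4)),
      ∃ v ∈ grayMap '' (C : Set (Fin 994 → ZMod 4)), u ≠ v ∧ hammingDist u v = m} 992 ∧
    ∀ D : Submodule (ZMod 2) (Fin 994 × Fin 2 → ZMod 2),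
      Module.finrank (ZMod 2) D = 12 → ∃ c ∈ D, c ≠ 0 ∧ hammingNorm c ≤ 991 := by
  refine ⟨?_, ⟨?_, ?_⟩, GrayCore.linear_bound⟩
  · rw [Nat.card_image_of_injective GrayCore.gray_inj]
    exact hcard
  · obtain ⟨c, hc, hc0, hw⟩ := hmin.1
    refine ⟨grayMap c, ⟨c, hc, rfl⟩, grayMap 0, ⟨0, C.zero_mem, rfl⟩, ?_, ?_⟩
    · exact fun h => hc0 (GrayCore.gray_inj h)
    · rw [GrayCore.gray_dist, sub_zero, hw]
  · rintro _ ⟨_, ⟨x, hx, rfl⟩, _, ⟨y, hy, rfl⟩, hne, rfl⟩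
    rw [GrayCore.gray_dist]
    refine hmin.2 ⟨x - y, C.sub_mem hx hy, ?_, rfl⟩
    intro h
    exact hne (by rw [sub_eq_zero.mp h])
end
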